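/- arXiv:1802.08144 — 2 statements merged into one kernel-verified Lean document; each statement's English description precedes it below -/
import Mathlib

section
/- Let D be a 6-angulation of the (4s+2)-gon, F_D the associated frieze of type Λ_6, T_D the associated triangulation and F_{T_D} its Conway–Coxeter frieze. Then F_D and F_{T_D} coincide in every odd-numbered row. -/
namespace FriezeNote

/-- `x` lies strictly between `a` and `b`, going in the positive direction
around the vertices `0, 1, …, m-1` of the `m`-gon. -/
def StrictBtw (m : ℕ) (a x b : ZMod m) : Prop :=
  0 < (x - a).val ∧ (x - a).val < (b - a).val

/-- Two chords of the `m`-gon cross (in the interior of the polygon). -/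
def Crosses (m : ℕ) (e f : Sym2 (ZMod m)) : Prop :=
  ∃ a b c d : ZMod m, e = s(a, b) ∧ f = s(c, d) ∧
    StrictBtw m a c b ∧ StrictBtw m b d a

/-- `e` is a diagonal of the `m`-gon: its endpoints are distinct and non-adjacent. -/
def IsDiagonal (m : ℕ) (e : Sym2 (ZMod m)) : Prop :=
  ∃ a b : ZMod m, e = s(a, b) ∧ a ≠ b ∧ b ≠ a + 1 ∧ a ≠ b + 1

/-- `e` is a boundary edge of the `m`-gon. -/
def IsPolyEdge (m : ℕ) (e : Sym2 (ZMod m)) : Prop :=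
  ∃ a : ZMod m, e = s(a, a + 1)

/-- A dissection of the `m`-gon: a set of pairwise non-crossing diagonals. -/
def IsDissection (m : ℕ) (D : Set (Sym2 (ZMod m))) : Prop :=
  (∀ e ∈ D, IsDiagonal m e) ∧ ∀ e ∈ D, ∀ f ∈ D, ¬ Crosses m e f

/-- `b` is the cyclic successor of `a` among the vertices of the finite set `C`:
both lie in `C` and no element of `C` lies strictly between them. -/
def CycConsec (m : ℕ) (C : Finset (ZMod m)) (a b : ZMod m) : Prop :=
  a ∈ C ∧ b ∈ C ∧ a ≠ b ∧ ∀ x ∈ C, ¬ StrictBtw m a x b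

/-- `C` is the vertex set of one of the subpolygons (cells) into which the
dissection `D` splits the `m`-gon: it has at least `3` vertices, cyclically
consecutive vertices of `C` are joined by a diagonal of `D` or a boundary edge,
and any diagonal of `D` with both endpoints in `C` joins cyclically consecutive
vertices of `C`. -/
def IsCell (m : ℕ) (D : Set (Sym2 (ZMod m))) (C : Finset (ZMod m)) : Prop :=
  3 ≤ C.card ∧
  (∀ a b : ZMod m, CycConsec m C a b → (s(a, b) ∈ D ∨ IsPolyEdge m s(a, b))) ∧
  (∀ a b : ZMod m, a ∈ C → b ∈ C → s(a, b) ∈ D →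
    (CycConsec m C a b ∨ CycConsec m C b a))

/-- `D` is a `p`-angulation of the `m`-gon: a dissection all of whose
subpolygons are `p`-gons. -/
def IsPAngulation (m p : ℕ) (D : Set (Sym2 (ZMod m))) : Prop :=
  IsDissection m D ∧ ∀ C : Finset (ZMod m), IsCell m D C → C.card = p

/-- The number of subpolygons of the dissection `D` incident with the vertex `α`. -/
noncomputable def cellCount (m : ℕ) (D : Set (Sym2 (ZMod m))) (α : ZMod m) : ℕ :=
  {C : Finset (ZMod m) | IsCell m D C ∧ α ∈ C}.ncard

/-- A frieze pattern of width `n`: rows numbered `0, …, n + 3` from below (entries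
of rows beyond `n + 3` are irrelevant), each row indexed by `ℤ`, rows `0` and
`n + 3` are zeroes, rows `1` and `n + 2` are ones, rows `2` through `n + 1` are
positive, and every diamond `b` (top), `a` (left), `d` (right), `c` (bottom)
satisfies `a * d - b * c = 1`. -/
structure Frieze (n : ℕ) where
  entry : ℕ → ℤ → ℝ
  nonneg : ∀ i k, i ≤ n + 3 → 0 ≤ entry i k
  row_zero : ∀ k, entry 0 k = 0
  row_top : ∀ k, entry (n + 3) k = 0
  row_one : ∀ k, entry 1 k = 1
  row_penult : ∀ k, entry (n + 2) k = 1
  row_pos : ∀ i k, 2 ≤ i → i ≤ n + 1 → 0 < entry i k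
  diamond : ∀ i k, 1 ≤ i → i ≤ n + 2 →
    entry i k * entry i (k + 1) - entry (i + 1) k * entry (i - 1) (k + 1) = 1

/-- `λ_p = 2 cos (π / p)`. -/
noncomputable def lambda (p : ℕ) : ℝ := 2 * Real.cos (Real.pi / p)

/-- A frieze pattern is of type `Λ_p` if every entry of its quiddity row (row `2`)
is a positive integral multiple of `λ_p`. -/
def IsTypeLambda (p : ℕ) {n : ℕ} (F : Frieze n) : Prop :=
  ∀ k : ℤ, ∃ q : ℕ, 0 < q ∧ F.entry 2 k = (q : ℝ) * lambda p

/-- `F` is the frieze of type `Λ_p` associated to the `p`-angulation `D` of the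
`m`-gon: its quiddity row is the periodic sequence `(λ_p q_0, …, λ_p q_{m-1})`. -/
def FriezeOfPAng (p m : ℕ) {n : ℕ} (F : Frieze n) (D : Set (Sym2 (ZMod m))) : Prop :=
  ∀ k : ℤ, F.entry 2 k = lambda p * (cellCount m D (k : ZMod m) : ℝ)

/-- `F` is the Conway–Coxeter frieze of the triangulation `T` of the `m`-gon:
its quiddity row is the periodic sequence `(t_0, …, t_{m-1})` where `t_α` is the
number of triangles of `T` incident with the vertex `α`. -/
def CCFrieze (m : ℕ) {n : ℕ} (F : Frieze n) (T : Set (Sym2 (ZMod m))) : Prop :=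
  ∀ k : ℤ, F.entry 2 k = (cellCount m T (k : ZMod m) : ℝ)

/-- A vertex of the `m`-gon is black when its label is odd (vertices are coloured
alternately, odd vertices black and even vertices white). -/
def IsBlack (m : ℕ) (a : ZMod m) : Prop := a.val % 2 = 1

/-- The set of chords joining two distinct black (odd) vertices of a common
subpolygon of the dissection `D`. -/
def oddPairs (m : ℕ) (D : Set (Sym2 (ZMod m))) : Set (Sym2 (ZMod m)) :=
  {e | ∃ (C : Finset (ZMod m)) (a b : ZMod m),
    IsCell m D C ∧ e = s(a, b) ∧ a ∈ C ∧ b ∈ C ∧ a ≠ b ∧ IsBlack m a ∧ IsBlack m b}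

/-- The triangulation associated to a dissection `D`: the diagonals of `D`
together with, inside each subpolygon, the chords joining pairs of its odd
(black) vertices. -/
def assocTriangulation (m : ℕ) (D : Set (Sym2 (ZMod m))) : Set (Sym2 (ZMod m)) :=
  D ∪ oddPairs m D

/-- `E` is a noncrossing tree on the black (odd) vertices of the `m`-gon:
its edges join distinct black vertices, are pairwise non-crossing, any two black
vertices are connected by a sequence of edges, and there is no loop of edges. -/
def IsNoncrossingTree (m : ℕ) (E : Set (Sym2 (ZMod m))) : Prop :=
  (∀ e ∈ E, ∃ a b : ZMod m, e = s(a, b) ∧ a ≠ b ∧ IsBlack m a ∧ IsBlack m b) ∧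
  (∀ e ∈ E, ∀ f ∈ E, ¬ Crosses m e f) ∧
  (∀ a b : ZMod m, IsBlack m a → IsBlack m b →
    (SimpleGraph.fromEdgeSet E).Reachable a b) ∧
  (SimpleGraph.fromEdgeSet E).IsAcyclic

/-- The inverse of the tree-of-quadrangulation map: it sends a noncrossing tree
`E` to the set of all black–white diagonals crossing no edge of `E`. -/
def quadOfTree (m : ℕ) (E : Set (Sym2 (ZMod m))) : Set (Sym2 (ZMod m)) :=
  {e | IsDiagonal m e ∧
    (∃ a b : ZMod m, e = s(a, b) ∧ IsBlack m a ∧ ¬ IsBlack m b) ∧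
    ∀ f ∈ E, ¬ Crosses m e f}

/-- `e` is a diagonal of the subpolygon with vertex set `C`: both endpoints are
distinct vertices of `C` which are not cyclically consecutive in `C`. -/
def CellDiagonal (m : ℕ) (C : Finset (ZMod m)) (e : Sym2 (ZMod m)) : Prop :=
  ∃ a b : ZMod m, e = s(a, b) ∧ a ∈ C ∧ b ∈ C ∧ a ≠ b ∧
    ¬ CycConsec m C a b ∧ ¬ CycConsec m C b a

/-- `e` is an edge of the subpolygon with vertex set `C`: it joins two
cyclically consecutive vertices of `C`. -/
def CellEdge (m : ℕ) (C : Finset (ZMod m)) (e : Sym2 (ZMod m)) : Prop :=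
  ∃ a b : ZMod m, e = s(a, b) ∧ (CycConsec m C a b ∨ CycConsec m C b a)

/-- `C` is an ear of the dissection `D`: a subpolygon all of whose edges except
exactly one are boundary edges of the polygon. -/
def IsEar (m : ℕ) (D : Set (Sym2 (ZMod m))) (C : Finset (ZMod m)) : Prop :=
  IsCell m D C ∧ ∃! e : Sym2 (ZMod m), CellEdge m C e ∧ ¬ IsPolyEdge m e

/-- The dual graph of a dissection `D`: vertices are the subpolygons of `D`, and
two subpolygons are adjacent when they share a common edge (a diagonal of `D`). -/
def dualGraph (m : ℕ) (D : Set (Sym2 (ZMod m))) :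
    SimpleGraph {C : Finset (ZMod m) // IsCell m D C} :=
  SimpleGraph.fromRel fun C C' =>
    ∃ e ∈ D, ∃ a b : ZMod m, e = s(a, b) ∧
      a ∈ C.1 ∧ b ∈ C.1 ∧ a ∈ C'.1 ∧ b ∈ C'.1

section aux
variable {m : ℕ}

lemma aux_val_sub [NeZero m] (u v : ZMod m) :
    (v.val ≤ u.val ∧ (u - v).val + v.val = u.val) ∨
      (u.val < v.val ∧ (u - v).val + v.val = u.val + m) := by
  rcases le_or_gt v.val u.val with h | h
  · left
    have := ZMod.val_sub h
    omega
  · right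
    have h1 := ZMod.val_sub h.le
    have h2 : u - v = -(v - u) := by ring
    have h3 : v - u ≠ 0 := by
      intro h0
      have : v = u := sub_eq_zero.mp h0
      subst this; omega
    have hv := ZMod.val_lt v
    rw [h2, ZMod.neg_val, if_neg h3]
    omega

lemma sb_iff [NeZero m] (o a x b : ZMod m) : StrictBtw m a x b ↔
    ((a - o).val < (x - o).val ∧ (x - o).val < (b - o).val) ∨
    ((x - o).val < (b - o).val ∧ (b - o).val < (a - o).val) ∨
    ((b - o).val < (a - o).val ∧ (a - o).val < (x - o).val) := by
  unfold StrictBtw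
  have h1 := aux_val_sub (x - o) (a - o)
  have h2 := aux_val_sub (b - o) (a - o)
  rw [sub_sub_sub_cancel_right] at h1 h2
  have := ZMod.val_lt (x - o)
  have := ZMod.val_lt (a - o)
  have := ZMod.val_lt (b - o)
  omega

lemma sb0 [NeZero m] (a x b : ZMod m) : StrictBtw m a x b ↔
    (a.val < x.val ∧ x.val < b.val) ∨
    (x.val < b.val ∧ b.val < a.val) ∨
    (b.val < a.val ∧ a.val < x.val) := by
  simpa using sb_iff 0 a x b

lemma veq [NeZero m] {a b : ZMod m} : a = b ↔ a.val = b.val :=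
  ⟨fun h => by rw [h], fun h => ZMod.val_injective m h⟩

lemma veqo [NeZero m] (o : ZMod m) {a b : ZMod m} : a = b ↔ (a - o).val = (b - o).val := by
  rw [← veq, sub_left_inj]

lemma sb_one [NeZero m] {u z : ZMod m} (h : StrictBtw m u z (u + 1)) : False := by
  obtain ⟨h1, h2⟩ := h
  have : (u + 1 - u : ZMod m) = 1 := by ring
  rw [this] at h2
  have : (1 : ZMod m).val ≤ 1 := by
    have := ZMod.val_one_eq_one_mod m
    rw [this]; exact Nat.mod_le _ _
  omega

lemma exists_third {C : Finset (ZMod m)} (h : 3 ≤ C.card) (u v : ZMod m) :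
    ∃ w ∈ C, w ≠ u ∧ w ≠ v := by
  by_contra! hc
  have : C ⊆ {u, v} := by
    intro w hw
    by_cases hwu : w = u
    · simp [hwu]
    · simp [hc w hw hwu]
  have := (Finset.card_le_card this).trans Finset.card_le_two
  omega

lemma edge_false [NeZero m] {C : Finset (ZMod m)} (h : 3 ≤ C.card) {u v z : ZMod m}
    (hc : CycConsec m C u v) (hz : StrictBtw m u z v) (he : IsPolyEdge m s(u, v)) : False := by
  obtain ⟨t, ht⟩ := he
  rw [Sym2.eq_iff] at ht
  rcases ht with ⟨rfl, rfl⟩ | ⟨rfl, rfl⟩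
  · exact sb_one hz
  · obtain ⟨w, hw, h1, h2⟩ := exists_third h (v + 1) v
    have h3 := hc.2.2.2 w hw
    have h4 : ¬ StrictBtw m v w (v + 1) := fun h => sb_one h
    have h5 := hc.2.2.1
    rw [sb0] at h3 h4
    rw [Ne, veq] at h1 h2 h5
    omega

lemma exists_succ [NeZero m] {C : Finset (ZMod m)} (h : 3 ≤ C.card) {a : ZMod m} (ha : a ∈ C) :
    ∃ b, CycConsec m C a b := by
  obtain ⟨w, hw, hwa, _⟩ := exists_third h a a
  obtain ⟨b, hb, hmin⟩ := Finset.exists_min_image (C.erase a) (fun z => (z - a).val)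
    ⟨w, by simp [hw, hwa]⟩
  rw [Finset.mem_erase] at hb
  refine ⟨b, ha, hb.2, hb.1.symm, fun x hx hs => ?_⟩
  obtain ⟨h1, h2⟩ := hs
  have hxa : x ≠ a := by rintro rfl; simp at h1
  have := hmin x (by simp [hx, hxa])
  omega

lemma succ_unique [NeZero m] {C : Finset (ZMod m)} {a b b' : ZMod m}
    (h : CycConsec m C a b) (h' : CycConsec m C a b') : b = b' := by
  have h1 := h.2.2.2 b' h'.2.1
  have h2 := h'.2.2.2 b h.2.1
  have h3 := h.2.2.1
  have h4 := h'.2.2.1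
  rw [sb0] at h1 h2
  rw [Ne, veq] at h3 h4
  rw [veq]
  omega

lemma exists_gap0 [NeZero m] {C : Finset (ZMod m)} (h : 3 ≤ C.card) {z : ZMod m} (hz : z ∉ C) :
    ∃ u v, CycConsec m C u v ∧ StrictBtw m u z v := by
  have hne : C.Nonempty := Finset.card_pos.mp (by omega)
  obtain ⟨v, hv, hmin⟩ := Finset.exists_min_image C (fun x => (x - z).val) hne
  obtain ⟨u, hu, hmax⟩ := Finset.exists_max_image C (fun x => (x - z).val) hne
  have hzz : (z - z : ZMod m).val = 0 := by simp
  have hvz : v ≠ z := by rintro rfl; exact hz hv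
  have huz : u ≠ z := by rintro rfl; exact hz hu
  obtain ⟨w, hw, hwu, hwv⟩ := exists_third h u v
  have e1 := hmin w hw
  have e2 := hmax w hw
  rw [Ne, veqo z] at hvz huz hwu hwv
  refine ⟨u, v, ⟨hu, hv, ?_, ?_⟩, ?_⟩
  · rw [Ne, veqo z]; omega
  · intro x hx
    have := hmin x hx
    have := hmax x hx
    rw [sb_iff z]; omega
  · rw [sb_iff z]; omega

lemma exists_gap [NeZero m] {D : Set (Sym2 (ZMod m))} {C : Finset (ZMod m)} (hC : IsCell m D C)
    {z : ZMod m} (hz : z ∉ C) :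
    ∃ u v, CycConsec m C u v ∧ StrictBtw m u z v ∧ s(u, v) ∈ D := by
  obtain ⟨u, v, h1, h2⟩ := exists_gap0 hC.1 hz
  refine ⟨u, v, h1, h2, ?_⟩
  rcases hC.2.1 u v h1 with h | h
  · exact h
  · exact (edge_false hC.1 h1 h2 h).elim

lemma nc {D : Set (Sym2 (ZMod m))} (hD : IsDissection m D) {a b c d : ZMod m}
    (h1 : s(a, b) ∈ D) (h2 : s(c, d) ∈ D) (h3 : StrictBtw m a c b) (h4 : StrictBtw m b d a) :
    False := hD.2 _ h1 _ h2 ⟨a, b, c, d, rfl, rfl, h3, h4⟩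

lemma side_mem [NeZero m] {D : Set (Sym2 (ZMod m))} (hD : IsDissection m D)
    {C : Finset (ZMod m)} (hC : IsCell m D C)
    {x y p q : ZMod m} (hxy : s(x, y) ∈ D) (hp : p ∈ C) (hq : q ∈ C)
    (h1 : StrictBtw m x p y) (h2 : StrictBtw m y q x) : y ∈ C := by
  by_contra hy
  obtain ⟨u, v, hc, hs, huv⟩ := exists_gap hC hy
  have e1 := hc.2.2.2 p hp
  have e2 := hc.2.2.2 q hq
  have : StrictBtw m x u y ∧ StrictBtw m y v x := by
    rw [sb0] at *
    rw [sb0]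
    omega
  exact nc hD hxy huv this.1 this.2

lemma side [NeZero m] {D : Set (Sym2 (ZMod m))} (hD : IsDissection m D)
    {C : Finset (ZMod m)} (hC : IsCell m D C)
    {x y p q : ZMod m} (hxy : s(x, y) ∈ D) (hp : p ∈ C) (hq : q ∈ C)
    (h1 : StrictBtw m x p y) (h2 : StrictBtw m y q x) : False := by
  have hy := side_mem hD hC hxy hp hq h1 h2
  have hx := side_mem hD hC (by rwa [Sym2.eq_swap]) hq hp h2 h1
  rcases hC.2.2 x y hx hy hxy with h | h
  · exact h.2.2.2 p hp h1
  · exact h.2.2.2 q hq h2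

lemma sep [NeZero m] {D : Set (Sym2 (ZMod m))} (hD : IsDissection m D)
    {C C' : Finset (ZMod m)} (hC : IsCell m D C) (hC' : IsCell m D C') (hne : C ≠ C') :
    ∃ u v, CycConsec m C u v ∧ s(u, v) ∈ D ∧ ∀ w ∈ C', ¬ StrictBtw m v w u := by
  have key : ∀ {C C' : Finset (ZMod m)} (hC : IsCell m D C) (hC' : IsCell m D C') {z : ZMod m}
      (hz' : z ∈ C') (hz : z ∉ C), ∃ u v, CycConsec m C u v ∧ s(u, v) ∈ D ∧
        ∀ w ∈ C', ¬ StrictBtw m v w u := by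
    intro C C' hC hC' z hz' hz
    obtain ⟨u, v, h1, h2, h3⟩ := exists_gap hC hz
    exact ⟨u, v, h1, h3, fun w hw hs => side hD hC' h3 hz' hw h2 hs⟩
  by_cases hsub : C' ⊆ C
  · exfalso
    have : ∃ z ∈ C, z ∉ C' := by
      by_contra! hh
      exact hne (Finset.Subset.antisymm hh hsub)
    obtain ⟨z, hz, hz'⟩ := this
    obtain ⟨u, v, h1, -, h3⟩ := key hC' hC hz hz'
    obtain ⟨w, hw, a1, a2⟩ := exists_third hC'.1 u v
    have b1 := h1.2.2.2 w hw
    have b2 := h3 w (hsub hw)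
    have b3 := h1.2.2.1
    rw [sb0] at b1 b2
    rw [Ne, veq] at a1 a2 b3
    omega
  · obtain ⟨z, hz', hz⟩ := Finset.not_subset.mp hsub
    exact key hC hC' hz' hz

lemma cell_unique [NeZero m] {D : Set (Sym2 (ZMod m))} (hD : IsDissection m D)
    {C C' : Finset (ZMod m)} (hC : IsCell m D C) (hC' : IsCell m D C') {x y : ZMod m}
    (h : CycConsec m C x y) (h' : CycConsec m C' x y) : C = C' := by
  by_contra hne
  obtain ⟨u, v, h1, -, h3⟩ := sep hD hC hC' hne
  obtain ⟨w, hw, a1, a2⟩ := exists_third hC.1 u v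
  obtain ⟨w', hw', a1', a2'⟩ := exists_third hC'.1 u v
  have c1 := h1.2.2.2 x h.1
  have c2 := h1.2.2.2 y h.2.1
  have c3 := h3 x h'.1
  have c4 := h3 y h'.2.1
  have d1 := h1.2.2.1
  have d2 := h.2.2.1
  have : (x = u ∧ y = v) ∨ (x = v ∧ y = u) := by
    rw [sb0] at c1 c2 c3 c4
    rw [Ne, veq] at d1 d2
    simp only [veq]
    omega
  rcases this with ⟨rfl, rfl⟩ | ⟨rfl, rfl⟩
  · have c6 := h3 w' hw'
    have c8 := h'.2.2.2 w' hw'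
    clear c1 c2 c3 c4
    rw [sb0] at c6 c8
    rw [Ne, veq] at a1' a2' d1
    omega
  · have c5 := h1.2.2.2 w hw
    have c7 := h.2.2.2 w hw
    clear c1 c2 c3 c4
    rw [sb0] at c5 c7
    rw [Ne, veq] at a1 a2 d1
    omega

/-- distinct cells do not cross -/
lemma cells_nc [NeZero m] {D : Set (Sym2 (ZMod m))} (hD : IsDissection m D)
    {C C' : Finset (ZMod m)} (hC : IsCell m D C) (hC' : IsCell m D C') {a b c d : ZMod m}
    (ha : a ∈ C) (hb : b ∈ C) (hc : c ∈ C') (hd : d ∈ C')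
    (h1 : StrictBtw m a c b) (h2 : StrictBtw m b d a) : C = C' := by
  by_contra hne
  obtain ⟨u, v, k1, -, k3⟩ := sep hD hC hC' hne
  have c1 := k1.2.2.2 a ha
  have c2 := k1.2.2.2 b hb
  have c3 := k3 c hc
  have c4 := k3 d hd
  have d1 := k1.2.2.1
  rw [sb0] at c1 c2 c3 c4 h1 h2
  rw [Ne, veq] at d1
  omega

/-- distinct cells share at most the endpoints of a diagonal -/
lemma cells_share [NeZero m] {D : Set (Sym2 (ZMod m))} (hD : IsDissection m D)
    {C C' : Finset (ZMod m)} (hC : IsCell m D C) (hC' : IsCell m D C') {a b : ZMod m}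
    (ha : a ∈ C) (hb : b ∈ C) (ha' : a ∈ C') (hb' : b ∈ C') (hab : a ≠ b)
    (hn : s(a, b) ∉ D) : C = C' := by
  by_contra hne
  obtain ⟨u, v, k1, k2, k3⟩ := sep hD hC hC' hne
  have c1 := k1.2.2.2 a ha
  have c2 := k1.2.2.2 b hb
  have c3 := k3 a ha'
  have c4 := k3 b hb'
  have d1 := k1.2.2.1
  have : (a = u ∧ b = v) ∨ (a = v ∧ b = u) := by
    rw [sb0] at c1 c2 c3 c4
    rw [Ne, veq] at d1 hab
    simp only [veq]
    omega
  rcases this with ⟨rfl, rfl⟩ | ⟨rfl, rfl⟩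
  · exact hn k2
  · exact hn (by rwa [Sym2.eq_swap])

lemma val_succ [NeZero m] (o p : ZMod m) (h : (p - o).val + 1 < m) :
    (p + 1 - o).val = (p - o).val + 1 := by
  have : p + 1 - o = (p - o) + 1 := by ring
  have h1 : (1 : ZMod m).val = 1 := by
    rw [ZMod.val_one_eq_one_mod, Nat.mod_eq_of_lt (by omega)]
  rw [this, ZMod.val_add_of_lt (by rw [h1]; exact h), h1]

lemma exists_cell [NeZero m] (hm : 3 ≤ m) {D : Set (Sym2 (ZMod m))} (hD : IsDissection m D)
    {x y : ZMod m} (hxy : s(x, y) ∈ D ∨ y = x + 1) :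
    ∃ C, IsCell m D C ∧ CycConsec m C x y := by
  classical
  obtain ⟨f, hf⟩ : ∃ f : ZMod m → ℕ, f = fun z => (z - y).val := ⟨_, rfl⟩
  have fsb : ∀ a x b : ZMod m, StrictBtw m a x b ↔ (f a < f x ∧ f x < f b) ∨
      (f x < f b ∧ f b < f a) ∨ (f b < f a ∧ f a < f x) := by
    intro a x b; rw [hf]; exact sb_iff y a x b
  have feq : ∀ {a b : ZMod m}, a = b ↔ f a = f b := by
    intro a b; rw [hf]; exact veqo y
  have flt : ∀ a, f a < m := by intro a; rw [hf]; exact ZMod.val_lt _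
  have fsucc : ∀ a, f a + 1 < m → f (a + 1) = f a + 1 := by
    intro a h; subst hf; exact val_succ y a h
  have fy : f y = 0 := by simp [hf]
  have hdiag : ∀ {a b : ZMod m}, s(a, b) ∈ D → a ≠ b ∧ b ≠ a + 1 ∧ a ≠ b + 1 := by
    intro a b h
    obtain ⟨a', b', h1, h2⟩ := hD.1 _ h
    rw [Sym2.eq_iff] at h1
    rcases h1 with ⟨rfl, rfl⟩ | ⟨rfl, rfl⟩
    · exact h2
    · exact ⟨h2.1.symm, h2.2.2, h2.2.1⟩
  have hL : 2 ≤ f x := by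
    have h1 : f x ≠ 0 := by
      intro h
      have : x = y := feq.mpr (by omega)
      subst this
      rcases hxy with h | h
      · exact (hdiag h).1 rfl
      · have := fsucc x (by omega)
        rw [← h] at this; omega
    have h2 : f x ≠ 1 := by
      intro h
      have h3 := fsucc y (by omega)
      have : x = y + 1 := feq.mpr (by omega)
      rcases hxy with h | h
      · exact (hdiag h).2.2 this
      · have := fsucc x (by omega)
        rw [← h] at this; omega
    omega
  obtain ⟨Arc, hArc⟩ : ∃ Arc : ZMod m → ZMod m → Prop, ∀ u v, Arc u v ↔
      (s(u, v) ∈ D ∧ f u < f v ∧ f v ≤ f x ∧ ¬ (f u = 0 ∧ f v = f x)) :=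
    ⟨fun u v => (s(u, v) ∈ D ∧ f u < f v ∧ f v ≤ f x ∧ ¬ (f u = 0 ∧ f v = f x)),
      fun _ _ => Iff.rfl⟩
  obtain ⟨C, hC⟩ : ∃ C : Finset (ZMod m), ∀ z, z ∈ C ↔
      (f z ≤ f x ∧ ∀ u v, Arc u v → ¬ (f u < f z ∧ f z < f v)) :=
    ⟨Finset.univ.filter fun z => (f z ≤ f x ∧ ∀ u v, Arc u v → ¬ (f u < f z ∧ f z < f v)),
      fun z => by simp⟩
  have hyC : y ∈ C := by
    rw [hC]; exact ⟨by omega, fun u v _ => by omega⟩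
  have hxC : x ∈ C := by
    rw [hC]; exact ⟨le_rfl, fun u v h => by have := ((hArc u v).mp h).2.2.1; omega⟩
  have key : ∀ p ∈ C, ∀ q ∈ C, f p < f q → (∀ r ∈ C, ¬ (f p < f r ∧ f r < f q)) →
      (q = p + 1 ∨ Arc p q) := by
    intro p hp q hq hpq hr
    have hp' := (hC p).mp hp
    have hq' := (hC q).mp hq
    have hsp := fsucc p (by have := flt q; omega)
    by_cases h1 : f q = f p + 1
    · left; exact feq.mpr (by omega)
    right
    have hcov : ∀ z, f p < f z → f z < f q → ∃ u v, Arc u v ∧ f u < f z ∧ f z < f v := by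
      intro z h2 h3
      by_contra! hcon
      exact hr z ((hC z).mpr ⟨by omega, fun u v h h' => by have := hcon u v h h'.1; omega⟩) ⟨h2, h3⟩
    have hcov1 : ∃ v, Arc p v := by
      obtain ⟨u, v, h, h2, h3⟩ := hcov (p + 1) (by omega) (by omega)
      have := hp'.2 u v h
      have : u = p := feq.mpr (by omega)
      subst this
      exact ⟨v, h⟩
    obtain ⟨v, hv, hmax⟩ := Finset.exists_max_image (Finset.univ.filter fun v => Arc p v) f
      (by obtain ⟨v, hv⟩ := hcov1; exact ⟨v, by simp [hv]⟩)
    simp only [Finset.mem_filter, Finset.mem_univ, true_and] at hv hmax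
    have e1 := hq'.2 p v hv
    have hv' := (hArc _ _).mp hv
    by_cases h2 : f v = f q
    · rwa [feq.mpr h2] at hv
    exfalso
    obtain ⟨u', v', h3, h4, h5⟩ := hcov v (by omega) (by omega)
    have h3' := (hArc _ _).mp h3
    have e2 := hp'.2 u' v' h3
    by_cases h6 : f u' = f p
    · rw [feq.mpr h6] at h3
      have := hmax v' h3
      omega
    · exact nc hD hv'.1 h3'.1 (by rw [fsb]; omega) (by rw [fsb]; omega)
  have hcxy : CycConsec m C x y := by
    refine ⟨hxC, hyC, fun h => by rw [feq] at h; omega, fun r hr => ?_⟩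
    have := ((hC r).mp hr).1
    rw [fsb]; omega
  refine ⟨C, ⟨?_, ?_, ?_⟩, hcxy⟩
  · have : ∃ r ∈ C, f y < f r ∧ f r < f x := by
      by_contra! hcon
      rcases key y hyC x hxC (by omega) (fun r hr h => by have := hcon r hr h.1; omega) with h | h
      · have := fsucc y (by omega)
        rw [← h] at this; omega
      · have := (hArc _ _).mp h
        omega
    obtain ⟨r, hr, h1, h2⟩ := this
    have hcard : ({y, r, x} : Finset (ZMod m)).card = 3 := by
      rw [Finset.card_eq_three]
      refine ⟨y, r, x, ?_, ?_, ?_, rfl⟩ <;> rw [Ne, feq] <;> omega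
    rw [← hcard]
    apply Finset.card_le_card
    intro z hz
    simp only [Finset.mem_insert, Finset.mem_singleton] at hz
    rcases hz with rfl | rfl | rfl <;> assumption
  · rintro a b ⟨ha, hb, hab, hr⟩
    rw [Ne, feq] at hab
    rcases lt_or_gt_of_ne hab with h | h
    · rcases key a ha b hb h (fun r hr' h' => hr r hr' (by rw [fsb]; omega)) with h1 | h1
      · right; exact ⟨a, by rw [h1]⟩
      · left; exact ((hArc _ _).mp h1).1
    · have e1 := hr y hyC
      have e2 := hr x hxC
      have e3 := ((hC a).mp ha).1
      rw [fsb] at e1 e2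
      have h1 : a = x := feq.mpr (by omega)
      have h2 : b = y := feq.mpr (by omega)
      subst h1 h2
      rcases hxy with h | h
      · exact Or.inl h
      · right; exact ⟨a, by rw [h]⟩
  · have main : ∀ a b, a ∈ C → b ∈ C → s(a, b) ∈ D → f a < f b →
        (CycConsec m C a b ∨ CycConsec m C b a) := by
      intro a b ha hb hab hlt
      by_cases h0 : f a = 0 ∧ f b = f x
      · right
        have h1 : a = y := feq.mpr (by omega)
        have h2 : b = x := feq.mpr (by omega)
        subst h1 h2; exact hcxy
      · left
        refine ⟨ha, hb, (hdiag hab).1, fun r hr => ?_⟩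
        have := ((hC r).mp hr).2 a b ((hArc _ _).mpr ⟨hab, hlt, ((hC b).mp hb).1, h0⟩)
        rw [fsb]; omega
    intro a b ha hb hab
    have hne := (hdiag hab).1
    rw [Ne, feq] at hne
    rcases lt_or_gt_of_ne hne with h | h
    · exact main a b ha hb hab h
    · exact (main b a hb ha (by rwa [Sym2.eq_swap]) h).symm

lemma diag_of_mem {D : Set (Sym2 (ZMod m))} (hD : IsDissection m D) {a b : ZMod m}
    (h : s(a, b) ∈ D) : a ≠ b ∧ b ≠ a + 1 ∧ a ≠ b + 1 := by
  obtain ⟨a', b', h1, h2⟩ := hD.1 _ h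
  rw [Sym2.eq_iff] at h1
  rcases h1 with ⟨rfl, rfl⟩ | ⟨rfl, rfl⟩
  · exact h2
  · exact ⟨h2.1.symm, h2.2.2, h2.2.1⟩

lemma cellCount_eq [NeZero m] (hm : 3 ≤ m) {D : Set (Sym2 (ZMod m))} (hD : IsDissection m D)
    (α : ZMod m) : cellCount m D α = {y | s(α, y) ∈ D ∨ y = α + 1}.ncard := by
  unfold cellCount
  symm
  have hex : ∀ y ∈ {y | s(α, y) ∈ D ∨ y = α + 1}, ∃ C, IsCell m D C ∧ CycConsec m C α y :=
    fun y hy => exists_cell hm hD hy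
  choose g hg using hex
  refine Set.ncard_congr g ?_ ?_ ?_
  · intro y hy
    exact ⟨(hg y hy).1, (hg y hy).2.1⟩
  · intro y y' hy hy' h
    have h1 := (hg y hy).2
    have h2 := (hg y' hy').2
    rw [h] at h1
    exact succ_unique h1 h2
  · rintro C ⟨hC, hα⟩
    obtain ⟨y, hy⟩ := exists_succ hC.1 hα
    have hy' : y ∈ {y | s(α, y) ∈ D ∨ y = α + 1} := by
      rcases hC.2.1 α y hy with h | ⟨t, ht⟩
      · exact Or.inl h
      · rw [Sym2.eq_iff] at ht
        rcases ht with ⟨rfl, h⟩ | ⟨rfl, rfl⟩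
        · exact Or.inr h
        · exfalso
          obtain ⟨w, hw, h1, h2⟩ := exists_third hC.1 (y + 1) y
          have h3 := hy.2.2.2 w hw
          have h4 : ¬ StrictBtw m y w (y + 1) := fun h => sb_one h
          have h5 := hy.2.2.1
          rw [sb0] at h3 h4
          rw [Ne, veq] at h1 h2 h5
          omega
    exact ⟨y, hy', cell_unique hD (hg y hy').1 hC (hg y hy').2 hy⟩

/-- Alternation in a six-element set of naturals with odd gaps. -/
lemma alt_six (P : Finset ℕ) (h0 : 0 ∈ P)
    (hgap : ∀ p ∈ P, ∀ q ∈ P, p < q → (∀ r ∈ P, ¬ (p < r ∧ r < q)) → (q - p) % 2 = 1)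
    (hcard : P.card = 6) :
    (P.filter fun p => p % 2 = 0).card = 3 ∧ ∀ L ∈ P, (∀ p ∈ P, p ≤ L) → L % 2 = 1 := by
  obtain ⟨E, hE⟩ : ∃ E : ℕ → ℕ, E = fun n => (P.filter fun p => p < n ∧ p % 2 = 0).card := ⟨_, rfl⟩
  obtain ⟨O, hO⟩ : ∃ O : ℕ → ℕ, O = fun n => (P.filter fun p => p < n ∧ p % 2 = 1).card := ⟨_, rfl⟩
  have step : ∀ p ∈ P, ∀ q, p < q → (∀ r ∈ P, ¬ (p < r ∧ r < q)) →
      (p % 2 = 0 → E q = E p + 1 ∧ O q = O p) ∧ (p % 2 = 1 → E q = E p ∧ O q = O p + 1) := by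
    intro p hp q hpq hr
    subst hE hO
    have ins : ∀ k, p % 2 = k → (P.filter fun r => r < q ∧ r % 2 = k).card =
        (P.filter fun r => r < p ∧ r % 2 = k).card + 1 := by
      intro k hk
      rw [← Finset.card_insert_of_notMem (s := P.filter fun r => r < p ∧ r % 2 = k) (a := p)
        (by simp)]
      congr 1
      ext r
      simp only [Finset.mem_filter, Finset.mem_insert]
      constructor
      · rintro ⟨h1, h2, h3⟩
        have := hr r h1
        by_cases hh : r = p
        · exact Or.inl hh
        · exact Or.inr ⟨h1, by omega, h3⟩
      · rintro (rfl | ⟨h1, h2, h3⟩)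
        · exact ⟨hp, hpq, hk⟩
        · exact ⟨h1, by omega, h3⟩
    have same : ∀ k, p % 2 ≠ k → (P.filter fun r => r < q ∧ r % 2 = k).card =
        (P.filter fun r => r < p ∧ r % 2 = k).card := by
      intro k hk
      congr 1
      ext r
      simp only [Finset.mem_filter]
      constructor
      · rintro ⟨h1, h2, h3⟩
        have := hr r h1
        have : r ≠ p := by rintro rfl; exact hk h3
        exact ⟨h1, by omega, h3⟩
      · rintro ⟨h1, h2, h3⟩
        exact ⟨h1, by omega, h3⟩
    exact ⟨fun h => ⟨ins 0 h, same 1 (by omega)⟩, fun h => ⟨same 0 (by omega), ins 1 h⟩⟩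
  have main : ∀ n, n ∈ P → (n % 2 = 0 → E n = O n) ∧ (n % 2 = 1 → E n = O n + 1) := by
    intro n
    induction n using Nat.strong_induction_on with
    | _ n ih =>
      intro hn
      by_cases hn0 : n = 0
      · subst hn0; subst hE hO; simp
      obtain ⟨p, hp, hmax⟩ := Finset.exists_max_image (P.filter fun p => p < n) id
        ⟨0, by simp [h0]; omega⟩
      simp only [Finset.mem_filter, id, and_imp] at hp hmax
      have hr : ∀ r ∈ P, ¬ (p < r ∧ r < n) := fun r hr h => by
        have := hmax r hr h.2; omega
      have g := hgap p hp.1 n hn hp.2 hr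
      have st := step p hp.1 n hp.2 hr
      have i := ih p hp.2 hp.1
      omega
  obtain ⟨L, hL, hmax⟩ := Finset.exists_max_image P id ⟨0, h0⟩
  simp only [id] at hmax
  have hr : ∀ r ∈ P, ¬ (L < r ∧ r < L + 1) := fun r _ h => by omega
  have st := step L hL (L + 1) (by omega) hr
  have i := main L hL
  have hEt : E (L + 1) = (P.filter fun p => p % 2 = 0).card := by
    subst hE
    show Finset.card _ = _
    congr 1; ext r
    simp only [Finset.mem_filter]
    constructor
    · rintro ⟨a, b, c⟩; exact ⟨a, c⟩
    · rintro ⟨a, c⟩; exact ⟨a, by have := hmax r a; omega, c⟩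
  have hOt : O (L + 1) = (P.filter fun p => ¬ p % 2 = 0).card := by
    subst hO
    show Finset.card _ = _
    congr 1; ext r
    simp only [Finset.mem_filter]
    constructor
    · rintro ⟨a, b, c⟩; exact ⟨a, by omega⟩
    · rintro ⟨a, c⟩; exact ⟨a, by have := hmax r a; omega, by omega⟩
  have tot := Finset.card_filter_add_card_filter_not (s := P) (fun p => p % 2 = 0)
  refine ⟨by omega, fun L' hL' hmax' => ?_⟩
  have : L' = L := le_antisymm (hmax L' hL') (hmax' L hL)
  subst this
  omega

lemma gap_odd_cell [NeZero m] {C : Finset (ZMod m)} {α : ZMod m} (hα : α ∈ C) (hcard : C.card = 6)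
    (hgap : ∀ u v, CycConsec m C u v → (u - α).val < (v - α).val → (v - u).val % 2 = 1) :
    (C.filter fun z => (z - α).val % 2 = 0).card = 3 ∧
      ∀ x ∈ C, (∀ z ∈ C, (z - α).val ≤ (x - α).val) → (x - α).val % 2 = 1 := by
  have inj : Function.Injective fun z : ZMod m => (z - α).val := fun a b h => (veqo α).mpr h
  have key := alt_six (C.image fun z => (z - α).val)
    (Finset.mem_image.mpr ⟨α, hα, by simp⟩) ?_
    (by rw [Finset.card_image_of_injective _ inj, hcard])
  · refine ⟨?_, fun x hx hmax => key.2 _ (Finset.mem_image_of_mem _ hx) ?_⟩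
    · rw [← key.1, Finset.filter_image, Finset.card_image_of_injective _ inj]
    · intro p hp
      obtain ⟨z, hz, rfl⟩ := Finset.mem_image.mp hp
      exact hmax z hz
  · intro p hp q hq hpq hr
    obtain ⟨u, hu, rfl⟩ := Finset.mem_image.mp hp
    obtain ⟨v, hv, rfl⟩ := Finset.mem_image.mp hq
    have := hgap u v ⟨hu, hv, ?_, ?_⟩ hpq
    · have h1 := aux_val_sub (v - α) (u - α)
      rw [sub_sub_sub_cancel_right] at h1
      omega
    · rintro rfl; omega
    · intro x hx
      have := hr _ (Finset.mem_image_of_mem _ hx)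
      rw [sb_iff α]
      omega

lemma val_succ_parity [NeZero m] (hm : m % 2 = 0) (a : ZMod m) :
    (a + 1).val % 2 ≠ a.val % 2 := by
  have h := ZMod.val_lt a
  by_cases h1 : a.val + 1 < m
  · have := val_succ 0 a (by simpa using h1)
    simp only [sub_zero] at this
    omega
  · have h2 : a.val + 1 = m := by omega
    have : (a + 1) = 0 := by
      have h3 : ((a.val + 1 : ℕ) : ZMod m) = 0 := by rw [h2]; simp
      simpa using h3
    rw [this]
    simp only [ZMod.val_zero]
    omega

/-- diagonals have odd length -/
lemma odd_len [NeZero m] (hm : 3 ≤ m) {D : Set (Sym2 (ZMod m))}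
    (hD : IsPAngulation m 6 D) : ∀ L, ∀ a b : ZMod m, (b - a).val = L →
      (s(a, b) ∈ D ∨ b = a + 1) → L % 2 = 1 := by
  intro L
  induction L using Nat.strong_induction_on with
  | _ L ih =>
    intro a b hL hab
    have h1 : (1 : ZMod m).val = 1 := by
      rw [ZMod.val_one_eq_one_mod, Nat.mod_eq_of_lt (by omega)]
    by_cases hb : b = a + 1
    · subst hb
      simp only [add_sub_cancel_left, h1] at hL
      omega
    have hab' : s(a, b) ∈ D := hab.resolve_right hb
    obtain ⟨C, hC, hcc⟩ := exists_cell hm hD.1 (x := b) (y := a) (Or.inl (by rwa [Sym2.eq_swap]))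
    have haa : (a - a : ZMod m).val = 0 := by simp
    have hle : ∀ z ∈ C, (z - a).val ≤ (b - a).val := by
      intro z hz
      have := hcc.2.2.2 z hz
      have hne := hcc.2.2.1
      rw [sb_iff a] at this
      rw [Ne, veqo a] at hne
      omega
    have key := gap_odd_cell hcc.2.1 (hD.2 C hC) ?_
    · rw [← hL]
      exact key.2 b hcc.1 hle
    · intro u v huv hlt
      have h2 := aux_val_sub (v - a) (u - a)
      rw [sub_sub_sub_cancel_right] at h2
      have hv := hle v huv.2.1
      have hlt' : (v - u).val < L := by
        by_contra hcon
        have hu0 : u = a := (veqo a).mpr (by omega)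
        have hvb : v = b := (veqo a).mpr (by omega)
        subst hu0 hvb
        obtain ⟨w, hw, w1, w2⟩ := exists_third hC.1 u v
        have c1 := huv.2.2.2 w hw
        have c2 := hcc.2.2.2 w hw
        have c3 := huv.2.2.1
        rw [sb0] at c1 c2
        rw [Ne, veq] at w1 w2 c3
        omega
      refine ih _ hlt' u v rfl ?_
      rcases hC.2.1 u v huv with h | ⟨t, ht⟩
      · exact Or.inl h
      · rw [Sym2.eq_iff] at ht
        rcases ht with ⟨rfl, h⟩ | ⟨rfl, rfl⟩
        · exact Or.inr h
        · exfalso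
          obtain ⟨w, hw, w1, w2⟩ := exists_third hC.1 (v + 1) v
          have h3 := huv.2.2.2 w hw
          have h4 : ¬ StrictBtw m v w (v + 1) := fun h => sb_one h
          have h5 := huv.2.2.1
          rw [sb0] at h3 h4
          rw [Ne, veq] at w1 w2 h5
          omega

lemma parity_sub [NeZero m] (hm : m % 2 = 0) (a b : ZMod m) :
    (b - a).val % 2 = (b.val + a.val) % 2 := by
  have := aux_val_sub b a
  omega

lemma parity_diag [NeZero m] (hm : 3 ≤ m) (hm2 : m % 2 = 0) {D : Set (Sym2 (ZMod m))}
    (hD : IsPAngulation m 6 D) {a b : ZMod m} (h : s(a, b) ∈ D) : a.val % 2 ≠ b.val % 2 := by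
  have h1 := odd_len hm hD _ a b rfl (Or.inl h)
  have := parity_sub hm2 a b
  omega

/-- each cell has three vertices of the color of any of its vertices -/
lemma cell_black [NeZero m] (hm : 3 ≤ m) (hm2 : m % 2 = 0) {D : Set (Sym2 (ZMod m))}
    (hD : IsPAngulation m 6 D) {C : Finset (ZMod m)} (hC : IsCell m D C) {α : ZMod m}
    (hα : α ∈ C) (hb : IsBlack m α) : (C.filter fun z => z.val % 2 = 1).card = 3 := by
  have key := (gap_odd_cell hα (hD.2 C hC) ?_).1
  · rw [← key]
    congr 1
    ext z
    simp only [Finset.mem_filter]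
    have := parity_sub hm2 α z
    unfold IsBlack at hb
    constructor
    · rintro ⟨h1, h2⟩; exact ⟨h1, by omega⟩
    · rintro ⟨h1, h2⟩; exact ⟨h1, by omega⟩
  · intro u v huv hlt
    have h1 := parity_sub hm2 u v
    rcases hC.2.1 u v huv with h | ⟨t, ht⟩
    · have := parity_diag hm hm2 hD h
      omega
    · have := val_succ_parity hm2 t
      rw [Sym2.eq_iff] at ht
      rcases ht with ⟨rfl, rfl⟩ | ⟨rfl, rfl⟩ <;> omega

lemma crosses_symm [NeZero m] {e f : Sym2 (ZMod m)} (h : Crosses m e f) : Crosses m f e := by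
  obtain ⟨a, b, c, d, rfl, rfl, h1, h2⟩ := h
  refine ⟨c, d, b, a, rfl, Sym2.eq_swap, ?_, ?_⟩ <;> rw [sb0] at * <;> omega

lemma D_odd_nc [NeZero m] {D : Set (Sym2 (ZMod m))} (hD : IsDissection m D)
    {e f : Sym2 (ZMod m)} (he : e ∈ D) (hf : f ∈ oddPairs m D) : ¬ Crosses m e f := by
  rintro ⟨a, b, c, d, rfl, rfl, h1, h2⟩
  obtain ⟨C, c', d', hC, heq, hc, hd, -⟩ := hf
  rw [Sym2.eq_iff] at heq
  rcases heq with ⟨rfl, rfl⟩ | ⟨rfl, rfl⟩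
  · exact side hD hC he hc hd h1 h2
  · exact side hD hC he hd hc h1 h2

lemma mem_oddPairs {D : Set (Sym2 (ZMod m))} {a b : ZMod m} : s(a, b) ∈ oddPairs m D ↔
    a ≠ b ∧ IsBlack m a ∧ IsBlack m b ∧ ∃ C, IsCell m D C ∧ a ∈ C ∧ b ∈ C := by
  constructor
  · rintro ⟨C, a', b', hC, heq, h1, h2, h3, h4, h5⟩
    rw [Sym2.eq_iff] at heq
    rcases heq with ⟨rfl, rfl⟩ | ⟨rfl, rfl⟩
    · exact ⟨h3, h4, h5, C, hC, h1, h2⟩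
    · exact ⟨h3.symm, h5, h4, C, hC, h2, h1⟩
  · rintro ⟨h3, h4, h5, C, hC, h1, h2⟩
    exact ⟨C, a, b, hC, rfl, h1, h2, h3, h4, h5⟩

lemma T_dissection [NeZero m] (hm : 3 ≤ m) (hm2 : m % 2 = 0) {D : Set (Sym2 (ZMod m))}
    (hD : IsPAngulation m 6 D) : IsDissection m (assocTriangulation m D) := by
  constructor
  · rintro e (he | ⟨C, a, b, hC, rfl, ha, hb, hab, hba, hbb⟩)
    · exact hD.1.1 e he
    · refine ⟨a, b, rfl, hab, ?_, ?_⟩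
      · rintro rfl
        have := val_succ_parity hm2 a
        unfold IsBlack at *; omega
      · rintro rfl
        have := val_succ_parity hm2 b
        unfold IsBlack at *; omega
  · rintro e (he | he) f (hf | hf)
    · exact hD.1.2 e he f hf
    · exact D_odd_nc hD.1 he hf
    · exact fun h => D_odd_nc hD.1 hf he (crosses_symm h)
    · rintro ⟨a, b, c, d, rfl, rfl, h1, h2⟩
      obtain ⟨h3, h4, h5, C, hC, ha, hb⟩ := mem_oddPairs.mp he
      obtain ⟨h3', h4', h5', C', hC', hc, hd⟩ := mem_oddPairs.mp hf
      have := cells_nc hD.1 hC hC' ha hb hc hd h1 h2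
      subst this
      have hcard := cell_black hm hm2 hD hC ha h4
      have hsub : ({a, b, c, d} : Finset (ZMod m)) ⊆ C.filter fun z => z.val % 2 = 1 := by
        intro z hz
        simp only [Finset.mem_insert, Finset.mem_singleton] at hz
        rw [Finset.mem_filter]
        rcases hz with rfl | rfl | rfl | rfl
        · exact ⟨ha, h4⟩
        · exact ⟨hb, h5⟩
        · exact ⟨hc, h4'⟩
        · exact ⟨hd, h5'⟩
      have h4 : ({a, b, c, d} : Finset (ZMod m)).card = 4 := by
        rw [sb0] at h1 h2
        rw [Finset.card_eq_succ_iff_cons.mpr]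
        refine ⟨a, {b, c, d}, ?_, ?_, ?_⟩
        · simp only [Finset.mem_insert, Finset.mem_singleton, veq]; omega
        · rw [Finset.cons_eq_insert]
        · rw [Finset.card_eq_three]
          refine ⟨b, c, d, ?_, ?_, ?_, rfl⟩ <;> rw [Ne, veq] <;> omega
      have := Finset.card_le_card hsub
      omega

lemma count_white [NeZero m] (hm : 3 ≤ m) (hm2 : m % 2 = 0) {D : Set (Sym2 (ZMod m))}
    (hD : IsPAngulation m 6 D) {α : ZMod m} (hα : ¬ IsBlack m α) :
    cellCount m (assocTriangulation m D) α = cellCount m D α := by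
  rw [cellCount_eq hm (T_dissection hm hm2 hD), cellCount_eq hm hD.1]
  congr 1
  ext y
  simp only [Set.mem_ofPred_eq, assocTriangulation, Set.mem_union, mem_oddPairs]
  tauto

lemma count_black [NeZero m] (hm : 3 ≤ m) (hm2 : m % 2 = 0) {D : Set (Sym2 (ZMod m))}
    (hD : IsPAngulation m 6 D) {α : ZMod m} (hα : IsBlack m α) :
    cellCount m (assocTriangulation m D) α = 3 * cellCount m D α := by
  classical
  have h1 := cellCount_eq hm hD.1 α
  rw [cellCount_eq hm (T_dissection hm hm2 hD)]
  have hset : {y | s(α, y) ∈ assocTriangulation m D ∨ y = α + 1} =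
      {y | s(α, y) ∈ D ∨ y = α + 1} ∪ {y | s(α, y) ∈ oddPairs m D} := by
    ext y
    simp only [Set.mem_ofPred_eq, assocTriangulation, Set.mem_union]
    tauto
  have hdisj : Disjoint {y | s(α, y) ∈ D ∨ y = α + 1} {y | s(α, y) ∈ oddPairs m D} := by
    rw [Set.disjoint_left]
    intro y hy hy'
    obtain ⟨-, h2, h3, -⟩ := mem_oddPairs.mp hy'
    unfold IsBlack at h2 h3
    rcases hy with h | rfl
    · have := parity_diag hm hm2 hD h
      omega
    · have := val_succ_parity hm2 α
      omega
  have hO : {y | s(α, y) ∈ oddPairs m D}.ncard = 2 * cellCount m D α := by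
    have e1 : {y | s(α, y) ∈ oddPairs m D} =
        (((Finset.univ.filter fun C : Finset (ZMod m) => IsCell m D C ∧ α ∈ C).biUnion
          fun C => (C.filter fun z => z.val % 2 = 1).erase α : Finset (ZMod m)) :
            Set (ZMod m)) := by
      ext y
      simp only [Set.mem_ofPred_eq, mem_oddPairs, Finset.coe_biUnion, Set.mem_iUnion,
        Finset.mem_coe, Finset.mem_filter, Finset.mem_univ, true_and, Finset.mem_erase]
      constructor
      · rintro ⟨a, b, c, C, d, e, f⟩
        exact ⟨C, ⟨d, e⟩, a.symm, f, c⟩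
      · rintro ⟨C, ⟨d, e⟩, a, f, c⟩
        exact ⟨Ne.symm a, hα, c, C, d, e, f⟩
    rw [e1, Set.ncard_coe_finset, Finset.card_biUnion]
    · rw [Finset.sum_congr rfl (g := fun _ => 2)]
      · rw [Finset.sum_const, smul_eq_mul, mul_comm]
        congr 1
        unfold cellCount
        rw [← Set.ncard_coe_finset]
        congr 1
        ext C; simp
      · intro C hC
        simp only [Finset.mem_filter, Finset.mem_univ, true_and] at hC
        rw [Finset.card_erase_of_mem, cell_black hm hm2 hD hC.1 hC.2 hα]
        rw [Finset.mem_filter]; exact ⟨hC.2, hα⟩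
    · intro C hC C' hC' hne
      simp only [Finset.coe_filter, Finset.mem_filter, Finset.mem_univ, true_and,
        Set.mem_ofPred_eq] at hC hC'
      refine Finset.disjoint_left.mpr ?_
      intro y hy hy'
      simp only [Finset.mem_erase, Finset.mem_filter] at hy hy'
      refine hne (cells_share hD.1 hC.1 hC'.1 hC.2 hy.2.1 hC'.2 hy'.2.1 (Ne.symm hy.1) ?_)
      intro h
      have := parity_diag hm hm2 hD h
      unfold IsBlack at hα
      omega
  rw [hset, Set.ncard_union_eq hdisj (Set.toFinite _) (Set.toFinite _), hO, ← h1]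
  ring

lemma frieze_compare {n : ℕ} (F G : Frieze n) (c : ℝ) (hc : 0 < c)
    (he : ∀ k : ℤ, Even k → F.entry 2 k = c * G.entry 2 k)
    (ho : ∀ k : ℤ, ¬ Even k → c * F.entry 2 k = G.entry 2 k) :
    ∀ i, i ≤ n + 3 → ∀ k : ℤ, (Odd i → F.entry i k = G.entry i k) ∧
      (Even i → (Even k → F.entry i k = c * G.entry i k) ∧
        (¬ Even k → c * F.entry i k = G.entry i k)) := by
  intro i
  induction i using Nat.strong_induction_on with
  | _ i ih =>
    intro hi k
    match i, ih, hi with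
    | 0, _, _ => simp [F.row_zero, G.row_zero]
    | 1, _, _ => simp [F.row_one, G.row_one]
    | 2, _, _ =>
      refine ⟨fun h => ?_, fun _ => ⟨he k, ho k⟩⟩
      exact absurd h (by decide)
    | j + 3, ih, hi =>
      have dF := F.diamond (j + 2) k (by omega) (by omega)
      have dG := G.diamond (j + 2) k (by omega) (by omega)
      have e : j + 2 - 1 = j + 1 := rfl
      rw [e] at dF dG
      have pG : 0 < G.entry (j + 1) (k + 1) := by
        rcases Nat.eq_zero_or_pos j with rfl | hj
        · simp [G.row_one]
        · exact G.row_pos _ _ (by omega) (by omega)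
      have pF : 0 < F.entry (j + 1) (k + 1) := by
        rcases Nat.eq_zero_or_pos j with rfl | hj
        · simp [F.row_one]
        · exact F.row_pos _ _ (by omega) (by omega)
      have i1 := ih (j + 1) (by omega) (by omega) (k + 1)
      have i2 := ih (j + 2) (by omega) (by omega) k
      have i3 := ih (j + 2) (by omega) (by omega) (k + 1)
      have hk : Even (k + 1) ↔ ¬ Even k := Int.even_add_one
      have a1 : j + 2 + 1 = j + 3 := rfl
      rw [a1] at dF dG
      rcases Nat.even_or_odd j with hj | hj
      · have o1 : Odd (j + 1) := hj.add_one
        have o2 : Even (j + 2) := by rw [Nat.even_add]; simp [hj]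
        have o3 : Odd (j + 3) := o2.add_one
        have prod : F.entry (j + 2) k * F.entry (j + 2) (k + 1) =
            G.entry (j + 2) k * G.entry (j + 2) (k + 1) := by
          by_cases hkk : Even k
          · have u1 := (i2.2 o2).1 hkk
            have u2 := (i3.2 o2).2 (by rw [hk]; simpa using hkk)
            rw [u1, ← u2]; ring
          · have u1 := (i2.2 o2).2 hkk
            have u2 := (i3.2 o2).1 (by rw [hk]; exact hkk)
            rw [u2, ← u1]; ring
        have u3 := i1.1 o1
        refine ⟨fun _ => ?_, fun h => absurd h (Nat.not_even_iff_odd.mpr o3)⟩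
        rw [u3, prod] at dF
        apply mul_right_cancel₀ pG.ne'
        linarith
      · have o1 : Even (j + 1) := hj.add_one
        have o2 : Odd (j + 2) := o1.add_one
        have o3 : Even (j + 3) := o2.add_one
        have v1 := i2.1 o2
        have v2 := i3.1 o2
        refine ⟨fun h => absurd o3 (Nat.not_even_iff_odd.mpr h), fun _ => ⟨fun hkk => ?_, fun hkk => ?_⟩⟩
        · have u := (i1.2 o1).2 (by rw [hk]; simpa using hkk)
          rw [v1, v2] at dF
          rw [← u] at dG
          apply mul_right_cancel₀ pF.ne'
          linarith
        · have u := (i1.2 o1).1 (by rw [hk]; exact hkk)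
          rw [v1, v2, u] at dF
          apply mul_right_cancel₀ pG.ne'
          linarith

lemma black_int (s : ℕ) (k : ℤ) : IsBlack (4 * s + 2) (k : ZMod (4 * s + 2)) ↔ ¬ Even k := by
  unfold IsBlack
  have h : (((k : ZMod (4 * s + 2)).val : ℕ) : ℤ) = k % ((4 * s + 2 : ℕ) : ℤ) := ZMod.val_intCast k
  rw [Int.even_iff]
  have h2 : k % ((4 * s + 2 : ℕ) : ℤ) % 2 = k % 2 :=
    Int.emod_emod_of_dvd k (by push_cast; exact ⟨2 * s + 1, by ring⟩)
  omega

end aux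

/-- For a `6`-angulation `D` of the `(4s+2)`-gon, the frieze `F` of type `Λ_6`
associated to `D` and the Conway–Coxeter frieze `G` of the associated
triangulation `T_D` coincide in every odd-numbered row. -/
theorem stmt13 (s : ℕ) (hs : 1 ≤ s) (D : Set (Sym2 (ZMod (4 * s + 2))))
    (hD : IsPAngulation (4 * s + 2) 6 D)
    (F G : Frieze (4 * s - 1))
    (hF : FriezeOfPAng 6 (4 * s + 2) F D)
    (hG : CCFrieze (4 * s + 2) G (assocTriangulation (4 * s + 2) D)) :
    ∀ i ≤ 4 * s + 2, Odd i → ∀ k : ℤ, F.entry i k = G.entry i k := by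
  have hm : 3 ≤ 4 * s + 2 := by omega
  have hm2 : (4 * s + 2) % 2 = 0 := by omega
  have hlam : lambda 6 = √3 := by
    unfold lambda
    push_cast
    rw [Real.cos_pi_div_six]; ring
  have h3 : √3 * √3 = (3 : ℝ) := Real.mul_self_sqrt (by norm_num)
  intro i hi hodd k
  refine (frieze_compare F G (√3) (by positivity) ?_ ?_ i (by omega) k).1 hodd
  · intro k hk
    rw [hF k, hG k, hlam, count_white hm hm2 hD (by rw [black_int]; simpa using hk)]
  · intro k hk
    rw [hF k, hG k, hlam, count_black hm hm2 hD (by rw [black_int]; exact hk)]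
    push_cast
    rw [← mul_assoc, h3]

end FriezeNote
end

section
/- Let D be a 6-angulation of the (4s+2)-gon with vertices labelled 0,…,4s+1. Then every diagonal of D joins an even vertex to an odd vertex, and the set of diagonals consisting of the diagonals of D together with, for every hexagon of D, the edges between all pairs of its odd vertices, is a triangulation of the (4s+2)-gon. -/
namespace FriezeNote

structure NC (m : ℕ) (R : ℕ → ℕ → Prop) : Prop where
  hm : 3 ≤ m
  lt : ∀ i j, R i j → i < j
  bd : ∀ i j, R i j → j < m
  step : ∀ i, i + 1 < m → R i (i + 1)
  root : R 0 (m - 1)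
  nc : ∀ i j k l, R i j → R k l → i < k → k < j → j < l → False

structure LCell (m : ℕ) (R : ℕ → ℕ → Prop) (C : Finset ℕ) : Prop where
  card : 3 ≤ C.card
  bd : ∀ x ∈ C, x < m
  cons : ∀ a ∈ C, ∀ b ∈ C, a < b → (∀ x ∈ C, ¬ (a < x ∧ x < b)) → R a b
  ends : ∀ a ∈ C, ∀ b ∈ C, a < b → (∀ x ∈ C, a ≤ x ∧ x ≤ b) → R a b
  diag : ∀ a ∈ C, ∀ b ∈ C, a < b → R a b →
    (∀ x ∈ C, ¬ (a < x ∧ x < b)) ∨ (∀ x ∈ C, a ≤ x ∧ x ≤ b)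

lemma next_exists {C : Finset ℕ} {u b : ℕ} (hb : b ∈ C) (h : u < b) :
    ∃ v ∈ C, u < v ∧ v ≤ b ∧ ∀ x ∈ C, ¬ (u < x ∧ x < v) := by
  classical
  obtain ⟨v, hv, hmin⟩ := (C.filter (fun x => u < x)).exists_min_image id
    ⟨b, by simp [hb, h]⟩
  simp only [Finset.mem_filter, id] at hv hmin
  refine ⟨v, hv.1, hv.2, hmin b ⟨hb, h⟩, fun x hx ⟨h1, h2⟩ => ?_⟩
  have := hmin x ⟨hx, h1⟩
  omega

lemma prev_exists {C : Finset ℕ} {u a : ℕ} (ha : a ∈ C) (h : a < u) :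
    ∃ v ∈ C, v < u ∧ a ≤ v ∧ ∀ x ∈ C, ¬ (v < x ∧ x < u) := by
  classical
  obtain ⟨v, hv, hmin⟩ := (C.filter (fun x => x < u)).exists_max_image id
    ⟨a, by simp [ha, h]⟩
  simp only [Finset.mem_filter, id] at hv hmin
  refine ⟨v, hv.1, hv.2, hmin a ⟨ha, h⟩, fun x hx ⟨h1, h2⟩ => ?_⟩
  have := hmin x ⟨hx, h2⟩
  omega

lemma gap_exists {C : Finset ℕ} {a b c : ℕ} (ha : a ∈ C) (hb : b ∈ C) (hc : c ∉ C)
    (h1 : a < c) (h2 : c < b) :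
    ∃ u ∈ C, ∃ v ∈ C, a ≤ u ∧ u < c ∧ c < v ∧ v ≤ b ∧ ∀ x ∈ C, ¬ (u < x ∧ x < v) := by
  obtain ⟨v, hv, hv1, hv2, hv3⟩ := next_exists hb h2
  obtain ⟨u, hu, hu1, hu2, hu3⟩ := prev_exists ha h1
  refine ⟨u, hu, v, hv, hu2, hu1, hv1, hv2, fun x hx ⟨h1, h2⟩ => ?_⟩
  rcases lt_trichotomy x c with h | h | h
  · exact hu3 x hx ⟨h1, h⟩
  · exact hc (h ▸ hx)
  · exact hv3 x hx ⟨h, h2⟩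

lemma LCell.gap {m : ℕ} {R : ℕ → ℕ → Prop} {C : Finset ℕ} (h : LCell m R C) {a b c : ℕ}
    (ha : a ∈ C) (hb : b ∈ C) (hc : c ∉ C) (h1 : a < c) (h2 : c < b) :
    ∃ u ∈ C, ∃ v ∈ C, a ≤ u ∧ u < c ∧ c < v ∧ v ≤ b ∧ R u v := by
  obtain ⟨u, hu, v, hv, h3, h4, h5, h6, h7⟩ := gap_exists ha hb hc h1 h2
  exact ⟨u, hu, v, hv, h3, h4, h5, h6, h.cons u hu v hv (by omega) h7⟩

lemma LCell.ext {m : ℕ} {R : ℕ → ℕ → Prop} {C : Finset ℕ} (h : LCell m R C) :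
    ∃ p ∈ C, ∃ q ∈ C, p < q ∧ R p q ∧ (∀ x ∈ C, p ≤ x ∧ x ≤ q) := by
  have hc := h.card
  have hne : C.Nonempty := Finset.card_pos.1 (by omega)
  have hlt : C.min' hne < C.max' hne := Finset.min'_lt_max'_of_card C (by omega)
  have hb : ∀ x ∈ C, C.min' hne ≤ x ∧ x ≤ C.max' hne :=
    fun x hx => ⟨C.min'_le x hx, C.le_max' x hx⟩
  exact ⟨_, C.min'_mem hne, _, C.max'_mem hne, hlt,
    h.ends _ (C.min'_mem hne) _ (C.max'_mem hne) hlt hb, hb⟩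

lemma cell_beneath {m : ℕ} {R : ℕ → ℕ → Prop} (h : NC m R) {i j : ℕ} (hij : R i j)
    (h2 : i + 2 ≤ j) :
    ∃ C, LCell m R C ∧ i ∈ C ∧ j ∈ C ∧ ∀ x ∈ C, i ≤ x ∧ x ≤ j := by
  classical
  have hjm := h.bd _ _ hij
  let P : ℕ → Prop := fun x => ∀ u v, R u v → i ≤ u → v ≤ j → u < x → x < v → (u = i ∧ v = j)
  let C := (Finset.Icc i j).filter P
  have mem : ∀ x, x ∈ C ↔ (i ≤ x ∧ x ≤ j) ∧ P x := fun x => by simp [C]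
  have hi : i ∈ C := by
    rw [mem]; refine ⟨by omega, fun u v h1 h2 h3 h4 h5 => by omega⟩
  have hj : j ∈ C := by
    rw [mem]; refine ⟨by omega, fun u v h1 h2 h3 h4 h5 => by omega⟩
  have key : ∀ u ∈ C, u < j → ∃ v ∈ C, u < v ∧ R u v ∧ ¬ (u = i ∧ v = j) ∧
      ∀ x ∈ C, ¬ (u < x ∧ x < v) := by
    intro u hu huj
    have hu' := (mem u).1 hu
    obtain ⟨v, hv, hmax⟩ := ((Finset.Icc i j).filter
      (fun v => R u v ∧ ¬ (u = i ∧ v = j))).exists_max_image id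
      ⟨u + 1, by
        simp only [Finset.mem_filter, Finset.mem_Icc]
        exact ⟨by omega, h.step u (by omega), by omega⟩⟩
    simp only [Finset.mem_filter, Finset.mem_Icc, id] at hv hmax
    have huv := h.lt _ _ hv.2.1
    refine ⟨v, ?_, huv, hv.2.1, hv.2.2, ?_⟩
    · rw [mem]
      refine ⟨hv.1, fun p q hpq hip hqj hpv hvq => ?_⟩
      by_contra hne
      rcases lt_trichotomy p u with hp | hp | hp
      · exact hne (hu'.2 p q hpq hip hqj hp (by omega))
      · subst hp
        have := hmax q ⟨by omega, hpq, hne⟩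
        omega
      · exact h.nc _ _ _ _ hv.2.1 hpq hp hpv hvq
    · intro x hx hx'
      exact hv.2.2 (((mem x).1 hx).2 u v hv.2.1 (by omega) (by omega) hx'.1 hx'.2)
  refine ⟨C, ⟨?_, ?_, ?_, ?_, ?_⟩, hi, hj, fun x hx => ((mem x).1 hx).1⟩
  · obtain ⟨v, hv, h3, h4, h5, h6⟩ := key i hi (by omega)
    have hvj := ((mem v).1 hv).1
    have : ({i, v, j} : Finset ℕ) ⊆ C := by
      intro x hx
      simp only [Finset.mem_insert, Finset.mem_singleton] at hx
      rcases hx with rfl | rfl | rfl <;> assumption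
    have hc : ({i, v, j} : Finset ℕ).card = 3 := by
      rw [Finset.card_eq_three]
      exact ⟨i, v, j, by omega, by omega, by omega, rfl⟩
    rw [← hc]; exact Finset.card_le_card this
  · intro x hx
    have := ((mem x).1 hx).1
    omega
  · intro a ha b hb hab hno
    have hbj := ((mem b).1 hb).1
    obtain ⟨v, hv, h3, h4, h5, h6⟩ := key a ha (by omega)
    have h7 := h6 b hb
    have h8 := hno v hv
    have : v = b := by omega
    exact this ▸ h4
  · intro a ha b hb hab hall
    have h3 := hall i hi
    have h4 := hall j hj
    have ha' := ((mem a).1 ha).1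
    have hb' := ((mem b).1 hb).1
    have h5 : a = i := by omega
    have h6 : b = j := by omega
    rw [h5, h6]; exact hij
  · intro a ha b hb hab hR
    have ha' := ((mem a).1 ha).1
    have hb' := ((mem b).1 hb).1
    by_cases he : a = i ∧ b = j
    · right
      intro x hx
      have := ((mem x).1 hx).1
      omega
    · left
      intro x hx hx'
      exact he (((mem x).1 hx).2 a b hR (by omega) (by omega) hx'.1 hx'.2)

lemma six {m : ℕ} {R : ℕ → ℕ → Prop} {C : Finset ℕ} (h : LCell m R C) (h6 : C.card = 6) :
    ∃ c0 c1 c2 c3 c4 c5, c0 < c1 ∧ c1 < c2 ∧ c2 < c3 ∧ c3 < c4 ∧ c4 < c5 ∧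
      (∀ x, x ∈ C ↔ x = c0 ∨ x = c1 ∨ x = c2 ∨ x = c3 ∨ x = c4 ∨ x = c5) ∧
      R c0 c1 ∧ R c1 c2 ∧ R c2 c3 ∧ R c3 c4 ∧ R c4 c5 ∧ R c0 c5 := by
  let f := C.orderEmbOfFin h6
  have hlt : ∀ a b : Fin 6, a < b → f a < f b := fun a b hab => f.strictMono hab
  have hmem : ∀ x, x ∈ C ↔ x = f 0 ∨ x = f 1 ∨ x = f 2 ∨ x = f 3 ∨ x = f 4 ∨ x = f 5 := by
    intro x
    have : x ∈ C ↔ x ∈ Set.range f := by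
      rw [Finset.range_orderEmbOfFin]; simp
    rw [this]
    constructor
    · rintro ⟨y, rfl⟩
      fin_cases y <;> simp
    · rintro (h | h | h | h | h | h) <;> exact ⟨_, h.symm⟩
  have h01 := hlt 0 1 (by decide)
  have h12 := hlt 1 2 (by decide)
  have h23 := hlt 2 3 (by decide)
  have h34 := hlt 3 4 (by decide)
  have h45 := hlt 4 5 (by decide)
  have hm : ∀ y, f y ∈ C := fun y => C.orderEmbOfFin_mem h6 y
  generalize f 0 = c0, f 1 = c1, f 2 = c2, f 3 = c3, f 4 = c4, f 5 = c5 at *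
  have m0 : c0 ∈ C := (hmem _).2 (by tauto)
  have m1 : c1 ∈ C := (hmem _).2 (by tauto)
  have m2 : c2 ∈ C := (hmem _).2 (by tauto)
  have m3 : c3 ∈ C := (hmem _).2 (by tauto)
  have m4 : c4 ∈ C := (hmem _).2 (by tauto)
  have m5 : c5 ∈ C := (hmem _).2 (by tauto)
  refine ⟨c0, c1, c2, c3, c4, c5, h01, h12, h23, h34, h45, hmem, ?_, ?_, ?_, ?_, ?_, ?_⟩
  · refine h.cons _ m0 _ m1 h01 fun x hx => ?_
    rw [hmem] at hx; omega
  · refine h.cons _ m1 _ m2 h12 fun x hx => ?_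
    rw [hmem] at hx; omega
  · refine h.cons _ m2 _ m3 h23 fun x hx => ?_
    rw [hmem] at hx; omega
  · refine h.cons _ m3 _ m4 h34 fun x hx => ?_
    rw [hmem] at hx; omega
  · refine h.cons _ m4 _ m5 h45 fun x hx => ?_
    rw [hmem] at hx; omega
  · refine h.ends _ m0 _ m5 (by omega) fun x hx => ?_
    rw [hmem] at hx; omega

lemma mod4 {m : ℕ} {R : ℕ → ℕ → Prop} (h : NC m R)
    (h6 : ∀ C, LCell m R C → C.card = 6) :
    ∀ n i j, j - i = n → R i j → (j - i) % 4 = 1 := by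
  intro n
  induction n using Nat.strong_induction_on with
  | _ n ih =>
    intro i j hn hR
    have hlt := h.lt _ _ hR
    by_cases h2 : i + 2 ≤ j
    · obtain ⟨C, hC, hi, hj, hb⟩ := cell_beneath h hR h2
      obtain ⟨c0, c1, c2, c3, c4, c5, h01, h12, h23, h34, h45, hmem, r0, r1, r2, r3, r4, r5⟩ :=
        six hC (h6 C hC)
      have b0 := hb c0 ((hmem _).2 (by tauto))
      have b5 := hb c5 ((hmem _).2 (by tauto))
      rw [hmem] at hi hj
      have e0 : c0 = i := by omega
      have e5 : c5 = j := by omega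
      have i0 := ih (c1 - c0) (by omega) _ _ rfl r0
      have i1 := ih (c2 - c1) (by omega) _ _ rfl r1
      have i2 := ih (c3 - c2) (by omega) _ _ rfl r2
      have i3 := ih (c4 - c3) (by omega) _ _ rfl r3
      have i4 := ih (c5 - c4) (by omega) _ _ rfl r4
      omega
    · omega

lemma cell_nc {m : ℕ} {R : ℕ → ℕ → Prop} (h : NC m R) {C : Finset ℕ} (hC : LCell m R C)
    {a b c d : ℕ} (ha : a ∈ C) (hb : b ∈ C) (hR : R c d) :
    ¬ (a < c ∧ c < b ∧ b < d) ∧ ¬ (c < a ∧ a < d ∧ d < b) := by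
  obtain ⟨p, hp, q, hq, hpq, hRpq, hall⟩ := hC.ext
  have ha' := hall a ha
  have hb' := hall b hb
  constructor
  · rintro ⟨h1, h2, h3⟩
    have hc : c ∈ C := by
      by_contra hc
      obtain ⟨u, hu, v, hv, h4, h5, h6, h7, h8⟩ := hC.gap ha hb hc h1 h2
      exact h.nc _ _ _ _ h8 hR h5 h6 (by omega)
    have hd : d ∈ C := by
      by_contra hd
      by_cases hdq : d < q
      · obtain ⟨u, hu, v, hv, h4, h5, h6, h7, h8⟩ := hC.gap hb hq hd h3 hdq
        exact h.nc _ _ _ _ hR h8 (by omega) h5 h6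
      · have : d ≠ q := fun e => hd (e ▸ hq)
        exact h.nc _ _ _ _ hRpq hR (by omega) (by omega) (by omega)
    rcases hC.diag c hc d hd (by omega) hR with h4 | h4
    · exact h4 b hb ⟨h2, h3⟩
    · have := h4 a ha
      omega
  · rintro ⟨h1, h2, h3⟩
    have hd : d ∈ C := by
      by_contra hd
      obtain ⟨u, hu, v, hv, h4, h5, h6, h7, h8⟩ := hC.gap ha hb hd h2 h3
      exact h.nc _ _ _ _ hR h8 (by omega) h5 h6
    have hc : c ∈ C := by
      by_contra hc
      by_cases hcp : p < c
      · obtain ⟨u, hu, v, hv, h4, h5, h6, h7, h8⟩ := hC.gap hp ha hc hcp h1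
        exact h.nc _ _ _ _ h8 hR (by omega) h6 (by omega)
      · have : c ≠ p := fun e => hc (e ▸ hp)
        exact h.nc _ _ _ _ hR hRpq (by omega) (by omega) (by omega)
    rcases hC.diag c hc d hd (by omega) hR with h4 | h4
    · exact h4 a ha ⟨h1, h2⟩
    · have := h4 b hb
      omega

lemma cells_cross {m : ℕ} {R : ℕ → ℕ → Prop} (h : NC m R) {C C' : Finset ℕ}
    (hC : LCell m R C) (hC' : LCell m R C') {x x' y y' : ℕ} (hx : x ∈ C) (hy : y ∈ C)
    (hx' : x' ∈ C') (hy' : y' ∈ C') (h1 : x < x') (h2 : x' < y) (h3 : y < y') :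
    x' ∈ C ∧ y' ∈ C := by
  obtain ⟨p, hp, q, hq, hpq, hRpq, hall⟩ := hC.ext
  have ha' := hall x hx
  have hb' := hall y hy
  constructor
  · by_contra hn
    obtain ⟨u, hu, v, hv, h4, h5, h6, h7, h8⟩ := hC.gap hx hy hn h1 h2
    exact (cell_nc h hC' hx' hy' h8).2 (by omega)
  · by_contra hn
    by_cases hq' : y' < q
    · obtain ⟨u, hu, v, hv, h4, h5, h6, h7, h8⟩ := hC.gap hy hq hn h3 hq'
      exact (cell_nc h hC' hx' hy' h8).1 (by omega)
    · have : y' ≠ q := fun e => hn (e ▸ hq)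
      exact (cell_nc h hC' hx' hy' hRpq).2 (by omega)

lemma pick_odd {c0 c1 c2 c3 c4 c5 x : ℕ} (q0 : (c0 + c1) % 2 = 1) (q1 : (c1 + c2) % 2 = 1)
    (q2 : (c2 + c3) % 2 = 1) (q3 : (c3 + c4) % 2 = 1) (q4 : (c4 + c5) % 2 = 1)
    (hx : x = c0 ∨ x = c1 ∨ x = c2 ∨ x = c3 ∨ x = c4 ∨ x = c5) (ho : x % 2 = 1) :
    (c0 % 2 = 0 → x = c1 ∨ x = c3 ∨ x = c5) ∧ (c0 % 2 = 1 → x = c0 ∨ x = c2 ∨ x = c4) := by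
  constructor
  · intro e
    have e1 : c1 % 2 = 1 := by omega
    have e2 : c2 % 2 = 0 := by omega
    have e3 : c3 % 2 = 1 := by omega
    have e4 : c4 % 2 = 0 := by omega
    clear q0 q1 q2 q3 q4
    rcases hx with rfl | rfl | rfl | rfl | rfl | rfl
    · omega
    · tauto
    · omega
    · tauto
    · omega
    · tauto
  · intro e
    have e1 : c1 % 2 = 0 := by omega
    have e2 : c2 % 2 = 1 := by omega
    have e3 : c3 % 2 = 0 := by omega
    have e4 : c4 % 2 = 1 := by omega
    have e5 : c5 % 2 = 0 := by omega
    clear q0 q1 q2 q3 q4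
    rcases hx with rfl | rfl | rfl | rfl | rfl | rfl
    · tauto
    · omega
    · tauto
    · omega
    · tauto
    · omega

lemma four_three {a b c i k j l : ℕ} (hi : i = a ∨ i = b ∨ i = c)
    (hk : k = a ∨ k = b ∨ k = c) (hj : j = a ∨ j = b ∨ j = c) (hl : l = a ∨ l = b ∨ l = c)
    (h1 : i < k) (h2 : k < j) (h3 : j < l) : False := by
  omega

lemma two_three {a b c i j : ℕ} (hab : a < b) (hbc : b < c) (hi : i = a ∨ i = b ∨ i = c)
    (hj : j = a ∨ j = b ∨ j = c) (h1 : i < j) :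
    (i = a ∧ j = b) ∨ (i = b ∧ j = c) ∨ (i = a ∧ j = c) := by
  omega

def RT (m : ℕ) (R : ℕ → ℕ → Prop) (i j : ℕ) : Prop :=
  R i j ∨ (i < j ∧ i % 2 = 1 ∧ j % 2 = 1 ∧ ∃ C, LCell m R C ∧ i ∈ C ∧ j ∈ C)

lemma RT_nc {m : ℕ} {R : ℕ → ℕ → Prop} (h : NC m R)
    (h6 : ∀ C, LCell m R C → C.card = 6) : NC m (RT m R) := by
  refine ⟨h.hm, ?_, ?_, fun i hi => Or.inl (h.step i hi), Or.inl h.root, ?_⟩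
  · rintro i j (h1 | h1)
    · exact h.lt _ _ h1
    · exact h1.1
  · rintro i j (h1 | ⟨-, -, -, C, hC, -, hj⟩)
    · exact h.bd _ _ h1
    · exact hC.bd j hj
  · rintro i j k l (h1 | ⟨-, hi2, hj2, C, hC, hi, hj⟩) (h2 | ⟨-, hk2, hl2, C', hC', hk, hl⟩) a b c
    · exact h.nc _ _ _ _ h1 h2 a b c
    · exact (cell_nc h hC' hk hl h1).2 ⟨a, b, c⟩
    · exact (cell_nc h hC hi hj h2).1 ⟨a, b, c⟩
    · obtain ⟨hk', hl'⟩ := cells_cross h hC hC' hi hj hk hl a b c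
      obtain ⟨c0, c1, c2, c3, c4, c5, h01, h12, h23, h34, h45, hmem, r0, r1, r2, r3, r4, r5⟩ :=
        six hC (h6 C hC)
      have i0 := mod4 h h6 _ _ _ rfl r0
      have i1 := mod4 h h6 _ _ _ rfl r1
      have i2 := mod4 h h6 _ _ _ rfl r2
      have i3 := mod4 h h6 _ _ _ rfl r3
      have i4 := mod4 h h6 _ _ _ rfl r4
      rw [hmem] at hi hj hk' hl'
      have q0 : (c0 + c1) % 2 = 1 := by omega
      have q1 : (c1 + c2) % 2 = 1 := by omega
      have q2 : (c2 + c3) % 2 = 1 := by omega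
      have q3 : (c3 + c4) % 2 = 1 := by omega
      have q4 : (c4 + c5) % 2 = 1 := by omega
      clear i0 i1 i2 i3 i4
      rcases Nat.mod_two_eq_zero_or_one c0 with e | e
      · exact four_three ((pick_odd q0 q1 q2 q3 q4 hi hi2).1 e) ((pick_odd q0 q1 q2 q3 q4 hk' hk2).1 e)
          ((pick_odd q0 q1 q2 q3 q4 hj hj2).1 e) ((pick_odd q0 q1 q2 q3 q4 hl' hl2).1 e) a b c
      · exact four_three ((pick_odd q0 q1 q2 q3 q4 hi hi2).2 e) ((pick_odd q0 q1 q2 q3 q4 hk' hk2).2 e)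
          ((pick_odd q0 q1 q2 q3 q4 hj hj2).2 e) ((pick_odd q0 q1 q2 q3 q4 hl' hl2).2 e) a b c

lemma RT_tri {m : ℕ} {R : ℕ → ℕ → Prop} (h : NC m R)
    (h6 : ∀ C, LCell m R C → C.card = 6) :
    ∀ i j, RT m R i j → i + 2 ≤ j → ∃ k, RT m R i k ∧ RT m R k j := by
  intro i j hR hij
  rcases hR with hR | ⟨-, hi2, hj2, C, hC, hi, hj⟩
  · obtain ⟨C, hC, hi, hj, hb⟩ := cell_beneath h hR hij
    obtain ⟨c0, c1, c2, c3, c4, c5, h01, h12, h23, h34, h45, hmem, r0, r1, r2, r3, r4, r5⟩ :=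
      six hC (h6 C hC)
    have i0 := mod4 h h6 _ _ _ rfl r0
    have i1 := mod4 h h6 _ _ _ rfl r1
    have i2 := mod4 h h6 _ _ _ rfl r2
    have i3 := mod4 h h6 _ _ _ rfl r3
    have i4 := mod4 h h6 _ _ _ rfl r4
    have m0 : c0 ∈ C := (hmem _).2 (by tauto)
    have m1 : c1 ∈ C := (hmem _).2 (by tauto)
    have m4 : c4 ∈ C := (hmem _).2 (by tauto)
    have m5 : c5 ∈ C := (hmem _).2 (by tauto)
    have b0 := hb c0 m0
    have b5 := hb c5 m5
    rw [hmem] at hi hj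
    have e0 : i = c0 := by omega
    have e5 : j = c5 := by omega
    subst e0 e5
    rcases Nat.mod_two_eq_zero_or_one i with e | e
    · exact ⟨c1, Or.inl r0, Or.inr ⟨by omega, by omega, by omega, C, hC, m1, m5⟩⟩
    · exact ⟨c4, Or.inr ⟨by omega, by omega, by omega, C, hC, m0, m4⟩, Or.inl r4⟩
  · obtain ⟨c0, c1, c2, c3, c4, c5, h01, h12, h23, h34, h45, hmem, r0, r1, r2, r3, r4, r5⟩ :=
      six hC (h6 C hC)
    have i0 := mod4 h h6 _ _ _ rfl r0
    have i1 := mod4 h h6 _ _ _ rfl r1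
    have i2 := mod4 h h6 _ _ _ rfl r2
    have i3 := mod4 h h6 _ _ _ rfl r3
    have i4 := mod4 h h6 _ _ _ rfl r4
    have m2 : c2 ∈ C := (hmem _).2 (by tauto)
    have m3 : c3 ∈ C := (hmem _).2 (by tauto)
    have hi' := hi
    have hj' := hj
    rw [hmem] at hi' hj'
    have q0 : (c0 + c1) % 2 = 1 := by omega
    have q1 : (c1 + c2) % 2 = 1 := by omega
    have q2 : (c2 + c3) % 2 = 1 := by omega
    have q3 : (c3 + c4) % 2 = 1 := by omega
    have q4 : (c4 + c5) % 2 = 1 := by omega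
    clear i0 i1 i2 i3 i4
    rcases Nat.mod_two_eq_zero_or_one c0 with e | e
    · have h1 := (pick_odd q0 q1 q2 q3 q4 hi' hi2).1 e
      have h2 := (pick_odd q0 q1 q2 q3 q4 hj' hj2).1 e
      have h3 := two_three (a := c1) (b := c3) (c := c5) (by omega) (by omega) h1 h2 (by omega)
      rcases h3 with ⟨rfl, rfl⟩ | ⟨rfl, rfl⟩ | ⟨rfl, rfl⟩
      · exact ⟨c2, Or.inl r1, Or.inl r2⟩
      · exact ⟨c4, Or.inl r3, Or.inl r4⟩
      · exact ⟨c3, Or.inr ⟨by omega, by omega, by omega, C, hC, hi, m3⟩,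
          Or.inr ⟨by omega, by omega, by omega, C, hC, m3, hj⟩⟩
    · have h1 := (pick_odd q0 q1 q2 q3 q4 hi' hi2).2 e
      have h2 := (pick_odd q0 q1 q2 q3 q4 hj' hj2).2 e
      have h3 := two_three (a := c0) (b := c2) (c := c4) (by omega) (by omega) h1 h2 (by omega)
      rcases h3 with ⟨rfl, rfl⟩ | ⟨rfl, rfl⟩ | ⟨rfl, rfl⟩
      · exact ⟨c1, Or.inl r0, Or.inl r1⟩
      · exact ⟨c3, Or.inl r2, Or.inl r3⟩
      · exact ⟨c2, Or.inr ⟨by omega, by omega, by omega, C, hC, hi, m2⟩,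
          Or.inr ⟨by omega, by omega, by omega, C, hC, m2, hj⟩⟩

def Tri (R : ℕ → ℕ → Prop) : Prop := ∀ i j, R i j → i + 2 ≤ j → ∃ k, R i k ∧ R k j

lemma tri_of_cell {m : ℕ} {R : ℕ → ℕ → Prop} (h : NC m R) (ht : Tri R) {C : Finset ℕ}
    (hC : LCell m R C) :
    ∃ i k j, i < k ∧ k < j ∧ C = {i, k, j} ∧ R i k ∧ R k j ∧ R i j := by
  obtain ⟨p, hp, q, hq, hpq, hR, hall⟩ := hC.ext
  have hmid : ∃ z ∈ C, z ≠ p ∧ z ≠ q := by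
    by_contra hcon
    push Not at hcon
    have : C ⊆ {p, q} := by
      intro x hx
      simp only [Finset.mem_insert, Finset.mem_singleton]
      by_cases e : x = p
      · exact Or.inl e
      · exact Or.inr (hcon x hx e)
    have := Finset.card_le_card this
    have := Finset.card_le_two (a := p) (b := q)
    have := hC.card
    omega
  obtain ⟨z, hz, hzp, hzq⟩ := hmid
  have hz' := hall z hz
  obtain ⟨k, hpk, hkq⟩ := ht p q hR (by omega)
  have l1 := h.lt _ _ hpk
  have l2 := h.lt _ _ hkq
  have hk : k ∈ C := by
    by_contra hk
    obtain ⟨u, hu, v, hv, h4, h5, h6, h7, h8⟩ := gap_exists hp hq hk l1 l2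
    have hRuv := hC.cons u hu v hv (by omega) h8
    by_cases e : u = p
    · have : v ≠ q := by
        rintro rfl
        exact h8 z hz (by omega)
      exact h.nc _ _ _ _ hRuv hkq h5 h6 (by omega)
    · exact h.nc _ _ _ _ hpk hRuv (by omega) h5 h6
  have c1 := hC.diag p hp k hk l1 hpk
  have c2 := hC.diag k hk q hq l2 hkq
  refine ⟨p, k, q, l1, l2, ?_, hpk, hkq, hR⟩
  ext x
  simp only [Finset.mem_insert, Finset.mem_singleton]
  constructor
  · intro hx
    have a1 : ¬ (p < x ∧ x < k) := by
      rcases c1 with c | c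
      · exact c x hx
      · have := c q hq; omega
    have a2 : ¬ (k < x ∧ x < q) := by
      rcases c2 with c | c
      · exact c x hx
      · have := c p hp; omega
    have := hall x hx
    omega
  · rintro (rfl | rfl | rfl) <;> assumption

lemma cell_of_tri {m : ℕ} {R : ℕ → ℕ → Prop} (h : NC m R) {i k j : ℕ}
    (h1 : R i k) (h2 : R k j) (h3 : R i j) : LCell m R {i, k, j} := by
  have l1 := h.lt _ _ h1
  have l2 := h.lt _ _ h2
  have b := h.bd _ _ h2
  constructor
  · apply le_of_eq
    symm
    rw [Finset.card_eq_three]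
    exact ⟨i, k, j, by omega, by omega, by omega, rfl⟩
  all_goals simp only [Finset.mem_insert, Finset.mem_singleton]
  · rintro x (rfl | rfl | rfl) <;> omega
  · rintro a (rfl | rfl | rfl) b (rfl | rfl | rfl) hab hx <;> first | assumption | omega
  · rintro a (rfl | rfl | rfl) b (rfl | rfl | rfl) hab hx <;> first | assumption | omega
  · rintro a (rfl | rfl | rfl) b (rfl | rfl | rfl) hab hx <;> first | omega | skip
    · left; omega
    · right; omega
    · left; omega

lemma min_chord {R : ℕ → ℕ → Prop} (P : ℕ → ℕ → Prop)
    (h : ∃ i j, R i j ∧ P i j) :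
    ∃ i j, R i j ∧ P i j ∧ ∀ i' j', R i' j' → P i' j' → j - i ≤ j' - i' := by
  classical
  have hex : ∃ n, ∃ i j, R i j ∧ P i j ∧ j - i = n := by
    obtain ⟨i, j, h1, h2⟩ := h
    exact ⟨_, i, j, h1, h2, rfl⟩
  obtain ⟨i, j, h1, h2, h3⟩ := Nat.find_spec hex
  refine ⟨i, j, h1, h2, fun i' j' h4 h5 => ?_⟩
  rw [h3]
  exact Nat.find_min' hex ⟨i', j', h4, h5, rfl⟩

lemma tri_max {m : ℕ} {R : ℕ → ℕ → Prop} (h : NC m R) (ht : Tri R) {x y : ℕ}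
    (hxy : x < y) (hy : y < m)
    (hn : ∀ i j, R i j → ¬ (x < i ∧ i < y ∧ y < j) ∧ ¬ (i < x ∧ x < j ∧ j < y)) : R x y := by
  have h3 := h.hm
  obtain ⟨i, j, hR, hP, hmin⟩ := min_chord (R := R) (fun i j => i ≤ x ∧ y ≤ j)
    ⟨0, m - 1, h.root, by omega⟩
  have hl := h.lt _ _ hR
  by_cases h2 : i + 2 ≤ j
  · obtain ⟨k, hik, hkj⟩ := ht i j hR h2
    have l1 := h.lt _ _ hik
    have l2 := h.lt _ _ hkj
    have c1 := hmin i k hik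
    have c2 := hmin k j hkj
    have n1 := (hn _ _ hik).2
    have n2 := (hn _ _ hkj).1
    have e1 : x = i := by omega
    have e2 : y = j := by omega
    rw [e1, e2]; exact hR
  · have e1 : x = i := by omega
    have e2 : y = j := by omega
    rw [e1, e2]; exact hR

lemma tri_count {m : ℕ} {R : ℕ → ℕ → Prop} (h : NC m R) (ht : Tri R) :
    {C : Finset ℕ | LCell m R C}.ncard = m - 2 := by
  classical
  have h3 := h.hm
  have hcard : (Finset.Ioo 0 (m - 1)).card = m - 2 := by
    simp; omega
  have hA : ∀ k, ∃ p : ℕ × ℕ, k ∈ Finset.Ioo 0 (m - 1) → R p.1 k ∧ R k p.2 ∧ R p.1 p.2 := by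
    intro k
    by_cases hk : k ∈ Finset.Ioo 0 (m - 1)
    · rw [Finset.mem_Ioo] at hk
      obtain ⟨i, j, hR, hP, hmin⟩ := min_chord (R := R) (fun i j => i < k ∧ k < j)
        ⟨0, m - 1, h.root, by omega⟩
      obtain ⟨k', hik, hkj⟩ := ht i j hR (by omega)
      have l1 := h.lt _ _ hik
      have l2 := h.lt _ _ hkj
      have c1 := hmin i k' hik
      have c2 := hmin k' j hkj
      have e : k' = k := by omega
      subst e
      exact ⟨(i, j), fun _ => ⟨hik, hkj, hR⟩⟩
    · exact ⟨(0, 0), fun h => absurd h hk⟩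
  choose f hf using hA
  let g : ℕ → Finset ℕ := fun k => {(f k).1, k, (f k).2}
  have hset : {C : Finset ℕ | LCell m R C} = ↑((Finset.Ioo 0 (m - 1)).image g) := by
    ext C
    simp only [Set.mem_ofPred_eq, Finset.coe_image, Set.mem_image, Finset.mem_coe]
    constructor
    · intro hC
      obtain ⟨i, k, j, h1, h2, rfl, r1, r2, r3⟩ := tri_of_cell h ht hC
      have hjm := h.bd _ _ r2
      have hk : k ∈ Finset.Ioo 0 (m - 1) := by rw [Finset.mem_Ioo]; omega
      refine ⟨k, hk, ?_⟩
      obtain ⟨s1, s2, s3⟩ := hf k hk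
      have t1 := h.lt _ _ s1
      have t2 := h.lt _ _ s2
      have e1 : (f k).1 = i := by
        rcases lt_trichotomy (f k).1 i with e | e | e
        · exact (h.nc _ _ _ _ s1 r3 e h1 h2).elim
        · exact e
        · exact (h.nc _ _ _ _ r1 s3 e t1 t2).elim
      have e2 : (f k).2 = j := by
        rcases lt_trichotomy (f k).2 j with e | e | e
        · exact (h.nc _ _ _ _ s3 r2 t1 t2 e).elim
        · exact e
        · exact (h.nc _ _ _ _ r3 s2 h1 h2 e).elim
      simp only [g, e1, e2]
    · rintro ⟨k, hk, rfl⟩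
      obtain ⟨s1, s2, s3⟩ := hf k hk
      exact cell_of_tri h s1 s2 s3
  rw [hset, Set.ncard_coe_finset, Finset.card_image_of_injOn, hcard]
  intro k hk k' hk' he
  obtain ⟨s1, s2, s3⟩ := hf k hk
  obtain ⟨s1', s2', s3'⟩ := hf k' hk'
  have t1 := h.lt _ _ s1
  have t2 := h.lt _ _ s2
  have t1' := h.lt _ _ s1'
  have t2' := h.lt _ _ s2'
  simp only [g] at he
  have m1 : ∀ x, x = (f k).1 ∨ x = k ∨ x = (f k).2 ↔ x = (f k').1 ∨ x = k' ∨ x = (f k').2 := by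
    intro x
    have := Finset.ext_iff.1 he x
    simpa using this
  have a1 := (m1 (f k).1).1 (by tauto)
  have a2 := (m1 k).1 (by tauto)
  have a3 := (m1 (f k).2).1 (by tauto)
  omega

lemma val_sub_ite {m : ℕ} [NeZero m] (x a : ZMod m) :
    (x - a).val = if a.val ≤ x.val then x.val - a.val else x.val + m - a.val := by
  have hx := ZMod.val_lt x
  have ha := ZMod.val_lt a
  split_ifs with h
  · exact ZMod.val_sub h
  · have h1 : (x - a).val + (a - x).val = m := by
      have : x - a = -(a - x) := by ring
      have hne : NeZero (a - x) := ⟨by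
        intro h0
        have : a = x := sub_eq_zero.1 h0
        subst this
        omega⟩
      rw [this, ZMod.val_neg_of_ne_zero]
      have := ZMod.val_lt (a - x)
      omega
    have h2 := ZMod.val_sub (show x.val ≤ a.val by omega)
    omega

lemma val_succ_s14 {m : ℕ} [NeZero m] (hm : 3 ≤ m) (a : ZMod m) :
    (a + 1).val = if a.val + 1 = m then 0 else a.val + 1 := by
  have ha := ZMod.val_lt a
  have h1 : (1 : ZMod m).val = 1 := by
    have : Fact (1 < m) := ⟨by omega⟩
    exact ZMod.val_one m
  rw [ZMod.val_add, h1]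
  split_ifs with h
  · rw [h]; exact Nat.mod_self m
  · exact Nat.mod_eq_of_lt (by omega)

lemma val_inj' {m : ℕ} [NeZero m] {a b : ZMod m} : a = b ↔ a.val = b.val :=
  ⟨fun h => h ▸ rfl, fun h => ZMod.val_injective m h⟩

lemma sbtw_iff {m : ℕ} [NeZero m] (a x b : ZMod m) : StrictBtw m a x b ↔
    (a.val < x.val ∧ x.val < b.val) ∨ (x.val < b.val ∧ b.val < a.val) ∨
    (b.val < a.val ∧ a.val < x.val) := by
  unfold StrictBtw
  rw [val_sub_ite, val_sub_ite]
  have hx := ZMod.val_lt x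
  have ha := ZMod.val_lt a
  have hb := ZMod.val_lt b
  split_ifs <;> omega

lemma cross_iff {m : ℕ} [NeZero m] {a b c d : ZMod m} (h1 : a.val < b.val) (h2 : c.val < d.val) :
    Crosses m s(a, b) s(c, d) ↔
      (a.val < c.val ∧ c.val < b.val ∧ b.val < d.val) ∨
      (c.val < a.val ∧ a.val < d.val ∧ d.val < b.val) := by
  unfold Crosses
  constructor
  · rintro ⟨a', b', c', d', e1, e2, e3, e4⟩
    rw [sbtw_iff] at e3 e4
    rw [Sym2.eq_iff] at e1 e2
    rcases e1 with ⟨rfl, rfl⟩ | ⟨rfl, rfl⟩ <;> rcases e2 with ⟨rfl, rfl⟩ | ⟨rfl, rfl⟩ <;> omega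
  · rintro (h | h)
    · refine ⟨a, b, c, d, rfl, rfl, ?_, ?_⟩ <;> rw [sbtw_iff] <;> omega
    · refine ⟨a, b, d, c, rfl, Sym2.eq_swap, ?_, ?_⟩ <;> rw [sbtw_iff] <;> omega

lemma poly_iff {m : ℕ} [NeZero m] (hm : 3 ≤ m) {a b : ZMod m} (h1 : a.val < b.val) :
    IsPolyEdge m s(a, b) ↔ b.val = a.val + 1 ∨ (a.val = 0 ∧ b.val + 1 = m) := by
  unfold IsPolyEdge
  have ha := ZMod.val_lt a
  have hb := ZMod.val_lt b
  constructor
  · rintro ⟨c, hc⟩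
    rw [Sym2.eq_iff] at hc
    have h := val_succ_s14 hm c
    split_ifs at h <;>
    rcases hc with ⟨rfl, rfl⟩ | ⟨rfl, rfl⟩ <;> omega
  · rintro (h | h)
    · refine ⟨a, ?_⟩
      have : b = a + 1 := by
        rw [val_inj', val_succ_s14 hm, if_neg (by omega), h]
      rw [this]
    · refine ⟨b, ?_⟩
      have : a = b + 1 := by
        rw [val_inj', val_succ_s14 hm, if_pos h.2, h.1]
      rw [← this, Sym2.eq_swap]

lemma diag_iff {m : ℕ} [NeZero m] (hm : 3 ≤ m) {a b : ZMod m} (h1 : a.val < b.val) :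
    IsDiagonal m s(a, b) ↔ ¬ (b.val = a.val + 1 ∨ (a.val = 0 ∧ b.val + 1 = m)) := by
  have ha := ZMod.val_lt a
  have hb := ZMod.val_lt b
  unfold IsDiagonal
  simp only [ne_eq, val_inj', val_succ_s14 hm]
  constructor
  · rintro ⟨c, d, he, h2, h3, h4⟩
    rw [Sym2.eq_iff] at he
    rcases he with ⟨rfl, rfl⟩ | ⟨rfl, rfl⟩ <;> split_ifs at h3 h4 <;> omega
  · intro h
    refine ⟨a, b, rfl, by omega, ?_, ?_⟩ <;> split_ifs <;> omega

lemma diag_rep {m : ℕ} [NeZero m] {e : Sym2 (ZMod m)} (h : IsDiagonal m e) :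
    ∃ a b : ZMod m, e = s(a, b) ∧ a.val < b.val := by
  obtain ⟨a, b, rfl, h1, -, -⟩ := h
  rw [ne_eq, val_inj'] at h1
  rcases lt_or_gt_of_ne h1 with h | h
  · exact ⟨a, b, rfl, h⟩
  · exact ⟨b, a, Sym2.eq_swap, h⟩

def RD (m : ℕ) (D : Set (Sym2 (ZMod m))) (i j : ℕ) : Prop :=
  i < j ∧ j < m ∧ (s((i : ZMod m), (j : ZMod m)) ∈ D ∨ j = i + 1 ∨ (i = 0 ∧ j + 1 = m))

lemma RD_val {m : ℕ} [NeZero m] (hm : 3 ≤ m) {D : Set (Sym2 (ZMod m))} {a b : ZMod m} :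
    RD m D a.val b.val ↔ a.val < b.val ∧ (s(a, b) ∈ D ∨ IsPolyEdge m s(a, b)) := by
  unfold RD
  simp only [ZMod.natCast_val, ZMod.cast_id', id]
  constructor
  · rintro ⟨h1, h2, h3⟩
    exact ⟨h1, by rw [poly_iff hm h1]; exact h3⟩
  · rintro ⟨h1, h3⟩
    rw [poly_iff hm h1] at h3
    exact ⟨h1, ZMod.val_lt b, h3⟩

lemma exists_val {m : ℕ} [NeZero m] {i : ℕ} (h : i < m) : ∃ a : ZMod m, a.val = i :=
  ⟨(i : ZMod m), ZMod.val_cast_of_lt h⟩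

lemma RD_nc {m : ℕ} [NeZero m] (hm : 3 ≤ m) {D : Set (Sym2 (ZMod m))}
    (hD : IsDissection m D) : NC m (RD m D) := by
  refine ⟨hm, fun i j h => h.1, fun i j h => h.2.1, fun i hi => ⟨by omega, hi, by tauto⟩,
    ⟨by omega, by omega, by right; right; omega⟩, ?_⟩
  intro i j k l h1 h2 h3 h4 h5
  have hl := h2.2.1
  obtain ⟨a, rfl⟩ := exists_val (m := m) (i := i) (by omega)
  obtain ⟨b, rfl⟩ := exists_val (m := m) (i := j) (by omega)
  obtain ⟨c, rfl⟩ := exists_val (m := m) (i := k) (by omega)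
  obtain ⟨d, rfl⟩ := exists_val (m := m) (i := l) (by omega)
  obtain ⟨l1, h1⟩ := (RD_val hm).1 h1
  obtain ⟨l2, h2⟩ := (RD_val hm).1 h2
  rw [poly_iff hm l1] at h1
  rw [poly_iff hm l2] at h2
  rcases h1 with h1 | h1
  · rcases h2 with h2 | h2
    · exact hD.2 _ h1 _ h2 ((cross_iff l1 l2).2 (by omega))
    · omega
  · omega

lemma mem_img {m : ℕ} [NeZero m] (C : Finset (ZMod m)) (a : ZMod m) :
    a.val ∈ C.image ZMod.val ↔ a ∈ C := by
  simp only [Finset.mem_image]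
  constructor
  · rintro ⟨x, hx, h⟩
    rw [val_inj'.2 h] at hx
    exact hx
  · intro h
    exact ⟨a, h, rfl⟩

lemma cell_iff {m : ℕ} [NeZero m] (hm : 3 ≤ m) {D : Set (Sym2 (ZMod m))}
    (hD : ∀ e ∈ D, IsDiagonal m e)
    (C : Finset (ZMod m)) : IsCell m D C ↔ LCell m (RD m D) (C.image ZMod.val) := by
  have hcard : (C.image ZMod.val).card = C.card :=
    Finset.card_image_of_injective _ (ZMod.val_injective m)
  constructor
  · rintro ⟨h1, h2, h3⟩
    refine ⟨by omega, ?_, ?_, ?_, ?_⟩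
    all_goals simp only [Finset.forall_mem_image]
    · intro x _
      exact ZMod.val_lt x
    · intro a ha b hb hab hno
      rw [RD_val hm]
      refine ⟨hab, h2 a b ⟨ha, hb, by rintro rfl; omega, fun x hx hs => ?_⟩⟩
      have := hno hx
      rw [sbtw_iff] at hs
      omega
    · intro a ha b hb hab hall
      rw [RD_val hm]
      refine ⟨hab, ?_⟩
      rw [Sym2.eq_swap]
      refine h2 b a ⟨hb, ha, by rintro rfl; omega, fun x hx hs => ?_⟩
      have := hall hx
      rw [sbtw_iff] at hs
      omega
    · intro a ha b hb hab hR
      rw [RD_val hm] at hR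
      obtain ⟨-, hR | hR⟩ := hR
      · rcases h3 a b ha hb hR with hc | hc
        · left
          intro x hx h
          exact hc.2.2.2 x hx ((sbtw_iff _ _ _).2 (by omega))
        · right
          intro x hx
          have := hc.2.2.2 x hx
          rw [sbtw_iff] at this
          omega
      · rw [poly_iff hm hab] at hR
        rcases hR with hR | hR
        · left
          intro x _
          omega
        · right
          intro x _
          have := ZMod.val_lt x
          omega
  · intro h
    refine ⟨by have := h.card; omega, ?_, ?_⟩
    · rintro a b ⟨ha, hb, hne, hno⟩
      rw [ne_eq, val_inj'] at hne
      rcases lt_or_gt_of_ne hne with hl | hl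
      · refine ((RD_val hm).1 (h.cons _ ((mem_img C a).2 ha) _ ((mem_img C b).2 hb) hl ?_)).2
        simp only [Finset.forall_mem_image]
        intro x hx hx'
        exact hno x hx ((sbtw_iff _ _ _).2 (by omega))
      · rw [Sym2.eq_swap]
        refine ((RD_val hm).1 (h.ends _ ((mem_img C b).2 hb) _ ((mem_img C a).2 ha) hl ?_)).2
        simp only [Finset.forall_mem_image]
        intro x hx
        have := hno x hx
        rw [sbtw_iff] at this
        omega
    · have key : ∀ a b : ZMod m, a ∈ C → b ∈ C → a.val < b.val → s(a, b) ∈ D →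
          (CycConsec m C a b ∨ CycConsec m C b a) := by
        intro a b ha hb hl hab
        have hd := h.diag _ ((mem_img C a).2 ha) _ ((mem_img C b).2 hb) hl
          ((RD_val hm).2 ⟨hl, Or.inl hab⟩)
        simp only [Finset.forall_mem_image] at hd
        rcases hd with hd | hd
        · left
          refine ⟨ha, hb, by rintro rfl; omega, fun x hx hs => ?_⟩
          have := hd hx
          rw [sbtw_iff] at hs
          omega
        · right
          refine ⟨hb, ha, by rintro rfl; omega, fun x hx hs => ?_⟩
          have := hd hx
          rw [sbtw_iff] at hs
          omega
      intro a b ha hb hab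
      rcases lt_trichotomy a.val b.val with hl | hl | hl
      · exact key a b ha hb hl hab
      · obtain ⟨c, d, he, hcd⟩ := diag_rep (hD _ hab)
        rw [Sym2.eq_iff] at he
        rcases he with ⟨rfl, rfl⟩ | ⟨rfl, rfl⟩ <;> omega
      · rw [Sym2.eq_swap] at hab
        exact (key b a hb ha hl hab).symm

lemma exists_preimage {m : ℕ} [NeZero m] (C' : Finset ℕ) (h : ∀ x ∈ C', x < m) :
    ∃ C : Finset (ZMod m), C.image ZMod.val = C' := by
  classical
  refine ⟨C'.image (fun i : ℕ => (i : ZMod m)), ?_⟩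
  rw [Finset.image_image]
  conv_rhs => rw [← Finset.image_id (s := C')]
  apply Finset.image_congr
  intro x hx
  exact ZMod.val_cast_of_lt (h x hx)

lemma RD_assoc {m : ℕ} [NeZero m] (hm : 3 ≤ m) {D : Set (Sym2 (ZMod m))}
    (hD : ∀ e ∈ D, IsDiagonal m e) :
    RD m (assocTriangulation m D) = RT m (RD m D) := by
  funext i j
  apply propext
  constructor
  · intro h
    have h1 := h.1
    have h2 := h.2.1
    obtain ⟨a, rfl⟩ := exists_val (m := m) (i := i) (by omega)
    obtain ⟨b, rfl⟩ := exists_val (m := m) (i := j) (by omega)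
    obtain ⟨-, (h | h) | h⟩ := (RD_val hm).1 h
    · exact Or.inl ((RD_val hm).2 ⟨h1, Or.inl h⟩)
    · obtain ⟨C, x, y, hC, he, hx, hy, hne, bx, bY⟩ := h
      rw [cell_iff hm hD] at hC
      rw [Sym2.eq_iff] at he
      rcases he with ⟨rfl, rfl⟩ | ⟨rfl, rfl⟩
      · exact Or.inr ⟨h1, bx, bY, _, hC, (mem_img _ _).2 hx, (mem_img _ _).2 hy⟩
      · exact Or.inr ⟨h1, bY, bx, _, hC, (mem_img _ _).2 hy, (mem_img _ _).2 hx⟩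
    · exact Or.inl ((RD_val hm).2 ⟨h1, Or.inr h⟩)
  · rintro (h | ⟨h1, bx, bY, C', hC, hi, hj⟩)
    · refine ⟨h.1, h.2.1, ?_⟩
      rcases h.2.2 with h | h
      · exact Or.inl (Or.inl h)
      · exact Or.inr h
    · obtain ⟨C, rfl⟩ := exists_preimage C' hC.bd
      have h2 := hC.bd _ hj
      obtain ⟨a, rfl⟩ := exists_val (m := m) (i := i) (by omega)
      obtain ⟨b, rfl⟩ := exists_val (m := m) (i := j) (by omega)
      refine (RD_val hm).2 ⟨h1, Or.inl (Or.inr ⟨C, a, b, (cell_iff hm hD C).2 hC, rfl,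
        (mem_img _ _).1 hi, (mem_img _ _).1 hj, by rintro rfl; omega, bx, bY⟩)⟩

lemma dissection_of_nc {m : ℕ} [NeZero m] (hm : 3 ≤ m) {D : Set (Sym2 (ZMod m))}
    (hD : ∀ e ∈ D, IsDiagonal m e) (h : NC m (RD m D)) : IsDissection m D := by
  refine ⟨hD, fun e he f hf hc => ?_⟩
  obtain ⟨a, b, rfl, h1⟩ := diag_rep (hD e he)
  obtain ⟨c, d, rfl, h2⟩ := diag_rep (hD f hf)
  have r1 := (RD_val hm).2 ⟨h1, Or.inl he⟩
  have r2 := (RD_val hm).2 ⟨h2, Or.inl hf⟩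
  rw [cross_iff h1 h2] at hc
  rcases hc with ⟨x, y, z⟩ | ⟨x, y, z⟩
  · exact h.nc _ _ _ _ r1 r2 x y z
  · exact h.nc _ _ _ _ r2 r1 x y z

/-- In a `6`-angulation `D` of the `(4s+2)`-gon, every diagonal of `D` joins an
even (white) vertex to an odd (black) vertex, and the diagonals of `D` together
with, for every hexagon of `D`, the edges between all pairs of its odd
vertices, form a triangulation of the `(4s+2)`-gon: a maximal set of pairwise
non-crossing diagonals, dissecting the polygon into `(4s+2) - 2` triangles. -/
theorem stmt14 (s : ℕ) (hs : 1 ≤ s) (D : Set (Sym2 (ZMod (4 * s + 2))))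
    (hD : IsPAngulation (4 * s + 2) 6 D) :
    (∀ e ∈ D, ∃ a b : ZMod (4 * s + 2), e = s(a, b) ∧
      IsBlack (4 * s + 2) a ∧ ¬ IsBlack (4 * s + 2) b) ∧
    IsDissection (4 * s + 2) (assocTriangulation (4 * s + 2) D) ∧
    (∀ E : Set (Sym2 (ZMod (4 * s + 2))), IsDissection (4 * s + 2) E →
      assocTriangulation (4 * s + 2) D ⊆ E → E = assocTriangulation (4 * s + 2) D) ∧
    (∀ C : Finset (ZMod (4 * s + 2)),
      IsCell (4 * s + 2) (assocTriangulation (4 * s + 2) D) C → C.card = 3) ∧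
    {C : Finset (ZMod (4 * s + 2)) |
      IsCell (4 * s + 2) (assocTriangulation (4 * s + 2) D) C}.ncard
        = (4 * s + 2) - 2 := by
  have hm : 3 ≤ 4 * s + 2 := by omega
  generalize hM : 4 * s + 2 = m at *
  have hm2 : m % 2 = 0 := by omega
  have : NeZero m := ⟨by omega⟩
  obtain ⟨hdis, h6'⟩ := hD
  have hDd := hdis.1
  have hN := RD_nc hm hdis
  have h6 : ∀ C, LCell m (RD m D) C → C.card = 6 := by
    intro C' hC
    obtain ⟨C, rfl⟩ := exists_preimage C' hC.bd
    rw [Finset.card_image_of_injective _ (ZMod.val_injective m)]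
    exact h6' C ((cell_iff hm hDd C).2 hC)
  have hRT := RD_assoc hm hDd
  have hNT := RT_nc hN h6
  have hTT : Tri (RT m (RD m D)) := RT_tri hN h6
  rw [← hRT] at hNT hTT
  have hTd : ∀ e ∈ assocTriangulation m D, IsDiagonal m e := by
    rintro e (he | ⟨C, a, b, hC, rfl, ha, hb, hne, ba, bb⟩)
    · exact hDd e he
    · unfold IsBlack at ba bb
      refine ⟨a, b, rfl, hne, ?_, ?_⟩
      · rw [ne_eq, val_inj', val_succ_s14 hm]
        split_ifs <;> omega
      · rw [ne_eq, val_inj', val_succ_s14 hm]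
        split_ifs <;> omega
  refine ⟨?_, dissection_of_nc hm hTd hNT, ?_, ?_, ?_⟩
  · intro e he
    obtain ⟨a, b, rfl, h1⟩ := diag_rep (hDd e he)
    have h4 := mod4 hN h6 _ _ _ rfl ((RD_val hm).2 ⟨h1, Or.inl he⟩)
    unfold IsBlack
    rcases Nat.mod_two_eq_zero_or_one a.val with h | h
    · exact ⟨b, a, Sym2.eq_swap, by omega, by omega⟩
    · exact ⟨a, b, rfl, by omega, by omega⟩
  · intro E hE hTE
    refine Set.Subset.antisymm (fun e he => ?_) hTE
    obtain ⟨x, y, rfl, hxy⟩ := diag_rep (hE.1 e he)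
    have hR : RD m (assocTriangulation m D) x.val y.val := by
      refine tri_max hNT hTT hxy (ZMod.val_lt y) fun i j hij => ?_
      have hij1 := hij.1
      have hij2 := hij.2.1
      obtain ⟨a, rfl⟩ := exists_val (m := m) (i := i) (by omega)
      obtain ⟨b, rfl⟩ := exists_val (m := m) (i := j) (by omega)
      have hy := ZMod.val_lt y
      obtain ⟨-, h | h⟩ := (RD_val hm).1 hij
      · have hc := hE.2 _ he _ (hTE h)
        rw [cross_iff hxy hij1] at hc
        omega
      · rw [poly_iff hm hij1] at h
        omega
    obtain ⟨-, h | h⟩ := (RD_val hm).1 hR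
    · exact h
    · have hd := hE.1 _ he
      rw [diag_iff hm hxy] at hd
      rw [poly_iff hm hxy] at h
      exact absurd h hd
  · intro C hC
    rw [cell_iff hm hTd] at hC
    obtain ⟨i, k, j, h1, h2, h3, -⟩ := tri_of_cell hNT hTT hC
    rw [← Finset.card_image_of_injective C (ZMod.val_injective m), h3, Finset.card_eq_three]
    exact ⟨i, k, j, by omega, by omega, by omega, rfl⟩
  · rw [← tri_count hNT hTT, ← Set.ncard_image_of_injective _
      (Finset.image_injective (ZMod.val_injective m))]
    congr 1
    ext C'
    constructor
    · rintro ⟨C, hC, rfl⟩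
      exact (cell_iff hm hTd C).1 hC
    · intro hC
      obtain ⟨C, rfl⟩ := exists_preimage C' (LCell.bd hC)
      exact ⟨C, (cell_iff hm hTd C).2 hC, rfl⟩

end FriezeNote
end
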